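/- arXiv:2104.13642 — 2 statements merged into one kernel-verified Lean document; each statement's English description precedes it below -/
import Mathlib

section
/- Let T : I → I be a piecewise C¹ expanding map of I = [0,1] preserving an absolutely continuous probability measure μ = h(x)dx with continuous density h, and let f : I → ℝ be piecewise C¹, finite-to-one, with f' ≠ 0. Assume μ( { x ∈ I : A₀(x) = {x} } ) = 1, where A₀(x) = { y ∈ I : f(y) = f(x) and f(Ty) = f(Tx) }. For r > 0 set S_r = { (x,y) ∈ I² : |f(x) − f(y)| < r }. Then the limit p_{0,2} := lim_{r→0} (μ⊗μ)( S_r ∩ (T×T)^{-1} S_r ) / (μ⊗μ)( S_r ) exists and equals [ ∫_I h(x)² / max( |f'(x)|, |(f∘T)'(x)| ) dx ] / [ ∫_I ( Σ_{y ∈ f^{-1}{f(x)}} h(y)/|f'(y)| ) h(x) dx ]. -/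
open MeasureTheory Set Filter Topology Metric

/-- `f` is piecewise `C¹` on `[a,b]`: there is a finite partition of `[a,b]` into intervals
on each of whose interiors `f` is `C¹`. -/
def PiecewiseC1On (f : ℝ → ℝ) (a b : ℝ) : Prop :=
  ∃ (n : ℕ) (t : Fin (n + 1) → ℝ), StrictMono t ∧ t 0 = a ∧ t (Fin.last n) = b ∧
    ∀ i : Fin n, ContDiffOn ℝ 1 f (Set.Ioo (t i.castSucc) (t i.succ))

/-- `S_r = {(x,y) ∈ I² : |f(x) - f(y)| < r}`. -/
def pairSet (f : ℝ → ℝ) (r : ℝ) : Set (ℝ × ℝ) :=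
  {p | p.1 ∈ Set.Icc (0:ℝ) 1 ∧ p.2 ∈ Set.Icc (0:ℝ) 1 ∧ |f p.1 - f p.2| < r}

/-- Abstract form of the piece structure. -/
lemma mo_pieces {f : ℝ → ℝ} (hf : PiecewiseC1On f 0 1)
    (hf' : ∀ x ∈ Set.Icc (0:ℝ) 1, DifferentiableAt ℝ f x → deriv f x ≠ 0) :
    ∃ (n : ℕ) (P : Fin n → Set ℝ),
      (∀ i, IsOpen (P i) ∧ (P i).OrdConnected ∧ P i ⊆ Ioo 0 1 ∧ InjOn f (P i) ∧
        ∀ x ∈ P i, HasStrictDerivAt f (deriv f x) x ∧ deriv f x ≠ 0) ∧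
      (Icc (0:ℝ) 1 \ ⋃ i, P i).Finite := by
  obtain ⟨n, t, ht, h0, h1, hC⟩ := hf
  refine ⟨n, fun i => Ioo (t i.castSucc) (t i.succ), ?_, ?_⟩
  · intro i
    have hsub : Ioo (t i.castSucc) (t i.succ) ⊆ Ioo 0 1 := by
      intro x hx
      have a : t 0 ≤ t i.castSucc := ht.monotone (Fin.zero_le _)
      have b : t i.succ ≤ t (Fin.last n) := ht.monotone (Fin.le_last _)
      rw [h0] at a; rw [h1] at b
      exact ⟨a.trans_lt hx.1, hx.2.trans_le b⟩
    have hstr : ∀ x ∈ Ioo (t i.castSucc) (t i.succ),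
        HasStrictDerivAt f (deriv f x) x ∧ deriv f x ≠ 0 := by
      intro x hx
      have hc : ContDiffAt ℝ 1 f x := (hC i).contDiffAt (isOpen_Ioo.mem_nhds hx)
      exact ⟨hc.hasStrictDerivAt (by simp),
        hf' x (Ioo_subset_Icc_self (hsub hx)) (hc.differentiableAt (by simp))⟩
    have key : ∀ x ∈ Ioo (t i.castSucc) (t i.succ), ∀ y ∈ Ioo (t i.castSucc) (t i.succ),
        x < y → f x ≠ f y := by
      intro x hx y hy hxy he
      obtain ⟨c, hc, hc0⟩ := exists_deriv_eq_zero hxy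
        ((hC i).continuousOn.mono (fun z hz => ⟨hx.1.trans_le hz.1, hz.2.trans_lt hy.2⟩)) he
      exact (hstr c ⟨hx.1.trans hc.1, hc.2.trans hy.2⟩).2 hc0
    refine ⟨isOpen_Ioo, ordConnected_Ioo, hsub, ?_, hstr⟩
    intro x hx y hy he
    rcases lt_trichotomy x y with h | h | h
    · exact absurd he (key x hx y hy h)
    · exact h
    · exact absurd he.symm (key y hy x hx h)
  · refine (Set.finite_range t).subset ?_
    rintro x ⟨hx, hxn⟩
    by_contra hr
    have hne : ∀ j, t j ≠ x := fun j hj => hr ⟨j, hj⟩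
    have hlt : ∀ j, t j < x := by
      intro j
      induction j using Fin.induction with
      | zero => exact lt_of_le_of_ne (h0 ▸ hx.1) (hne 0)
      | succ i ih =>
        by_contra hcon
        exact hxn (mem_iUnion.2 ⟨i, ih, lt_of_le_of_ne (not_lt.1 hcon) (hne _).symm⟩)
    have := hlt (Fin.last n)
    rw [h1] at this
    exact absurd hx.2 (not_le.2 this)

/-- Localization. -/
lemma mo_localize {f : ℝ → ℝ} {n : ℕ} {P : Fin n → Set ℝ}
    (hP : ∀ i, IsOpen (P i) ∧ (P i).OrdConnected ∧ P i ⊆ Ioo 0 1 ∧ InjOn f (P i) ∧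
        ∀ x ∈ P i, HasStrictDerivAt f (deriv f x) x ∧ deriv f x ≠ 0)
    (z : ℝ) (hz : ∀ i, z ∉ frontier (f '' P i))
    (W : ℝ → Set ℝ) (hW : ∀ y ∈ Icc (0:ℝ) 1, f y = z → W y ∈ 𝓝 y) :
    ∀ᶠ r in 𝓝[>] (0:ℝ), ∀ y' ∈ ⋃ i, P i, |z - f y'| < r →
      ∃ y ∈ Icc (0:ℝ) 1, f y = z ∧ y' ∈ W y := by
  have : ∀ i, ∀ᶠ r in 𝓝[>] (0:ℝ), ∀ y' ∈ P i, |z - f y'| < r →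
      ∃ y ∈ Icc (0:ℝ) 1, f y = z ∧ y' ∈ W y := by
    intro i
    obtain ⟨ho, -, hs, hinj, hd⟩ := hP i
    have main : ∃ ε > 0, ∀ y' ∈ P i, |z - f y'| < ε →
        ∃ y ∈ Icc (0:ℝ) 1, f y = z ∧ y' ∈ W y := by
      by_cases hzi : z ∈ f '' P i
      · obtain ⟨y, hy, hyz⟩ := hzi
        have hyI := Ioo_subset_Icc_self (hs hy)
        have h1 := (hd y hy).1.map_nhds_eq (hd y hy).2
        have h2 : f '' (W y ∩ P i) ∈ 𝓝 (f y) := by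
          rw [← h1]
          exact image_mem_map (inter_mem (hW y hyI hyz) (ho.mem_nhds hy))
        obtain ⟨ε, hε, hb⟩ := Metric.mem_nhds_iff.1 h2
        refine ⟨ε, hε, fun y' hy' hlt => ⟨y, hyI, hyz, ?_⟩⟩
        have : f y' ∈ ball (f y) ε := by
          rw [mem_ball, Real.dist_eq, abs_sub_comm, hyz]; exact hlt
        obtain ⟨y'', hy'', he⟩ := hb this
        rw [← hinj hy''.2 hy' he]
        exact hy''.1
      · have hcl : z ∉ closure (f '' P i) := by
          intro hc
          exact hz i ⟨hc, fun hi => hzi (interior_subset hi)⟩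
        obtain ⟨ε, hε, hb⟩ := Metric.mem_nhds_iff.1 (isClosed_closure.isOpen_compl.mem_nhds hcl)
        refine ⟨ε, hε, fun y' hy' hlt => ?_⟩
        exfalso
        have : f y' ∈ ball z ε := by
          rw [mem_ball, Real.dist_eq, abs_sub_comm]; exact hlt
        exact hb this (subset_closure (mem_image_of_mem f hy'))
    obtain ⟨ε, hε, h⟩ := main
    filter_upwards [Ioo_mem_nhdsGT hε] with r hr y' hy' hlt
    exact h y' hy' (hlt.trans hr.2)
  filter_upwards [eventually_all.2 this] with r hr y' hy'
  obtain ⟨i, hi⟩ := mem_iUnion.1 hy'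
  exact hr i y' hi

lemma mo_preimage_null {f : ℝ → ℝ} {n : ℕ} {P : Fin n → Set ℝ} (hfm : Measurable f)
    (hP : ∀ i, IsOpen (P i) ∧ (P i).OrdConnected ∧ P i ⊆ Ioo 0 1 ∧ InjOn f (P i) ∧
        ∀ x ∈ P i, HasStrictDerivAt f (deriv f x) x ∧ deriv f x ≠ 0)
    (hB : (Icc (0:ℝ) 1 \ ⋃ i, P i).Finite) {N : Set ℝ} (hNm : MeasurableSet N)
    (hN : volume N = 0) :
    volume (Icc (0:ℝ) 1 ∩ f ⁻¹' N) = 0 := by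
  have h1 : ∀ i, volume (P i ∩ f ⁻¹' N) = 0 := by
    intro i
    obtain ⟨ho, -, hs, hinj, hd⟩ := hP i
    have hm : MeasurableSet (P i ∩ f ⁻¹' N) := ho.measurableSet.inter (hfm hNm)
    have h2 := lintegral_image_eq_lintegral_abs_deriv_mul (s := P i ∩ f ⁻¹' N) hm
      (fun x hx => ((hd x hx.1).1.hasDerivAt).hasDerivWithinAt)
      (hinj.mono inter_subset_left) (fun _ => 1)
    have h3 : volume (f '' (P i ∩ f ⁻¹' N)) = 0 :=
      measure_mono_null (by rintro _ ⟨x, hx, rfl⟩; exact hx.2) hN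
    simp only [lintegral_one, Measure.restrict_apply_univ, h3, mul_one] at h2
    have h4 := (lintegral_eq_zero_iff (by
      exact (((measurable_deriv f).abs).ennreal_ofReal))).1 h2.symm
    rw [Filter.EventuallyEq, ae_restrict_iff' hm] at h4
    refine measure_mono_null ?_ h4
    intro x hx hx2
    have := hx2 hx
    simp only [Pi.zero_apply, ENNReal.ofReal_eq_zero, abs_nonpos_iff] at this
    exact (hd x hx.1).2 this
  refine measure_mono_null (t := (Icc (0:ℝ) 1 \ ⋃ i, P i) ∪ ⋃ i, (P i ∩ f ⁻¹' N)) ?_ ?_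
  · rintro x ⟨hx, hxN⟩
    by_cases h : x ∈ ⋃ i, P i
    · right
      obtain ⟨i, hi⟩ := mem_iUnion.1 h
      exact mem_iUnion.2 ⟨i, hi, hxN⟩
    · left; exact ⟨hx, h⟩
  · exact measure_union_null (hB.measure_zero _) (measure_iUnion_null h1)

lemma mo_pratt {α : Type*} [MeasurableSpace α] {μ : Measure α}
    {U D : ℝ → α → ENNReal} {u d : α → ENNReal}
    (hU : ∀ r, Measurable (U r)) (hD : ∀ r, Measurable (D r))
    (hUD : ∀ r x, U r x ≤ D r x)
    (hUlim : ∀ᵐ x ∂μ, Tendsto (fun r => U r x) (𝓝[>] 0) (𝓝 (u x)))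
    (hDlim : ∀ᵐ x ∂μ, Tendsto (fun r => D r x) (𝓝[>] 0) (𝓝 (d x)))
    (hle : ∀ r, 0 < r → ∫⁻ x, D r x ∂μ ≤ ∫⁻ x, d x ∂μ)
    (hfin : ∫⁻ x, d x ∂μ ≠ ⊤) :
    Tendsto (fun r => ∫⁻ x, U r x ∂μ) (𝓝[>] 0) (𝓝 (∫⁻ x, u x ∂μ)) := by
  refine tendsto_of_seq_tendsto fun r hr => ?_
  have hUl : ∀ᵐ x ∂μ, Tendsto (fun n => U (r n) x) atTop (𝓝 (u x)) :=
    hUlim.mono fun x hx => hx.comp hr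
  have hDl : ∀ᵐ x ∂μ, Tendsto (fun n => D (r n) x) atTop (𝓝 (d x)) :=
    hDlim.mono fun x hx => hx.comp hr
  have hum : AEMeasurable u μ :=
    aemeasurable_of_tendsto_metrizable_ae atTop (fun n => (hU (r n)).aemeasurable) hUl
  have hdm : AEMeasurable d μ :=
    aemeasurable_of_tendsto_metrizable_ae atTop (fun n => (hD (r n)).aemeasurable) hDl
  have hdfin : ∀ᵐ x ∂μ, d x < ⊤ := ae_lt_top' hdm hfin
  have hud : ∀ᵐ x ∂μ, u x ≤ d x := by
    filter_upwards [hUl, hDl] with x h1 h2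
    exact le_of_tendsto_of_tendsto' h1 h2 (fun n => hUD _ _)
  have hsum : ∫⁻ x, d x ∂μ = ∫⁻ x, u x ∂μ + ∫⁻ x, (d x - u x) ∂μ := by
    rw [← lintegral_add_left' hum]
    refine lintegral_congr_ae ?_
    filter_upwards [hud] with x hx
    exact (add_tsub_cancel_of_le hx).symm
  have hsumn : ∀ n, ∫⁻ x, D (r n) x ∂μ = ∫⁻ x, U (r n) x ∂μ +
      ∫⁻ x, (D (r n) x - U (r n) x) ∂μ := by
    intro n
    rw [← lintegral_add_left (hU _)]
    refine lintegral_congr fun x => ?_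
    exact (add_tsub_cancel_of_le (hUD _ _)).symm
  have f1 : ∫⁻ x, u x ∂μ ≤ liminf (fun n => ∫⁻ x, U (r n) x ∂μ) atTop := by
    refine le_trans (le_of_eq (lintegral_congr_ae ?_))
      (lintegral_liminf_le (fun n => hU (r n)))
    filter_upwards [hUl] with x hx
    exact hx.liminf_eq.symm
  have f2 : ∫⁻ x, (d x - u x) ∂μ ≤ liminf (fun n => ∫⁻ x, (D (r n) x - U (r n) x) ∂μ) atTop := by
    refine le_trans (le_of_eq (lintegral_congr_ae ?_))
      (lintegral_liminf_le (fun n => (hD (r n)).sub (hU (r n))))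
    filter_upwards [hUl, hDl, hdfin] with x hx hx2 hx3
    exact (ENNReal.Tendsto.sub hx2 hx (Or.inl hx3.ne)).liminf_eq.symm
  refine tendsto_of_le_liminf_of_limsup_le f1 ?_
  have hpos : ∀ᶠ n in atTop, 0 < r n := by
    have := hr.eventually (self_mem_nhdsWithin : Ioi (0:ℝ) ∈ 𝓝[>] 0)
    exact this
  calc limsup (fun n => ∫⁻ x, U (r n) x ∂μ) atTop
      ≤ limsup (fun n => ∫⁻ x, d x ∂μ - ∫⁻ x, (D (r n) x - U (r n) x) ∂μ) atTop := by
        refine limsup_le_limsup ?_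
        filter_upwards [hpos] with n hn
        have h := hle (r n) hn
        have hs := hsumn n
        refine ENNReal.le_sub_of_add_le_right ?_ (hs ▸ h)
        refine ne_top_of_le_ne_top hfin (le_trans ?_ (hs ▸ h))
        exact le_add_self
    _ = ∫⁻ x, d x ∂μ - liminf (fun n => ∫⁻ x, (D (r n) x - U (r n) x) ∂μ) atTop :=
        ENNReal.limsup_const_sub _ _ hfin
    _ ≤ ∫⁻ x, d x ∂μ - ∫⁻ x, (d x - u x) ∂μ := tsub_le_tsub_left f2 _
    _ = ∫⁻ x, u x ∂μ := by
        rw [hsum]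
        refine ENNReal.add_sub_cancel_right ?_
        refine ne_top_of_le_ne_top hfin ?_
        rw [hsum]; exact le_add_self

lemma mo_upper {g : ℝ → ENNReal} (hg : Measurable g) {ν : Measure ℝ} 
    (hν : ν = volume.withDensity g) (r : ℝ) :
    ∫⁻ z, ν (ball z r) ∂ν ≤ ENNReal.ofReal (2 * r) * ∫⁻ z, g z ∂ν := by
  have hE : MeasurableSet {p : ℝ × ℝ | dist p.2 p.1 < r} :=
    measurableSet_lt (measurable_snd.dist measurable_fst) measurable_const
  set e : ℝ → ℝ → ENNReal := fun z w => indicator {p : ℝ × ℝ | dist p.2 p.1 < r} 1 (z, w) with he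
  have hem : Measurable (Function.uncurry e) := measurable_one.indicator hE
  have hemz : ∀ z, Measurable (e z) := fun z => hem.of_uncurry_left
  have hemw : ∀ w, Measurable (fun z => e z w) := fun w => hem.of_uncurry_right
  have hb1 : ∀ z (G : ℝ → ENNReal), ∫⁻ w, e z w * G w = ∫⁻ w in ball z r, G w := by
    intro z G
    rw [← lintegral_indicator measurableSet_ball]
    refine lintegral_congr fun w => ?_
    by_cases h : dist w z < r <;> simp [he, indicator, h]
  have hb2 : ∀ z, ∫⁻ w, e z w = ENNReal.ofReal (2 * r) := by
    intro z
    have := hb1 z 1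
    simpa using this
  have hsym : ∀ z w, e z w = e w z := by
    intro z w; simp [he, indicator, dist_comm]
  have hb3 : ∀ w, ∫⁻ z, e z w = ENNReal.ofReal (2 * r) := by
    intro w; rw [← hb2 w]; exact lintegral_congr fun z => hsym z w
  have hgg : Measurable (fun z => g z * g z) := hg.mul hg
  have hball : ∀ z, ν (ball z r) = ∫⁻ w, e z w * g w := by
    intro z; rw [hb1, hν, withDensity_apply _ measurableSet_ball]
  have hmm : Measurable (fun z => ∫⁻ w, e z w * g w) :=
    Measurable.lintegral_prod_right' (f := fun p : ℝ × ℝ => e p.1 p.2 * g p.2)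
      (hem.mul (hg.comp measurable_snd))
  have l1 : ∫⁻ z, ν (ball z r) ∂ν = ∫⁻ z, ∫⁻ w, e z w * (g z * g w) := by
    simp_rw [hball]
    rw [hν, lintegral_withDensity_eq_lintegral_mul _ hg hmm]
    refine lintegral_congr fun z => ?_
    simp only [Pi.mul_apply]
    rw [← lintegral_const_mul _ (show Measurable (fun w => e z w * g w) from (hemz z).mul hg)]
    refine lintegral_congr fun w => ?_
    ring
  have l2 : ∫⁻ z, g z ∂ν = ∫⁻ z, g z * g z := by
    rw [hν, lintegral_withDensity_eq_lintegral_mul _ hg hg]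
    rfl
  have amgm : ∀ a b : ENNReal, 2 * (a * b) ≤ a * a + b * b := by
    intro a b
    rcases eq_or_ne a ⊤ with ha | ha
    · subst ha; simp
    rcases eq_or_ne b ⊤ with hb | hb
    · subst hb; simp
    lift a to NNReal using ha
    lift b to NNReal using hb
    norm_cast
    rw [← NNReal.coe_le_coe]
    push_cast
    nlinarith [sq_nonneg ((a:ℝ) - b)]
  have l3 : 2 * ∫⁻ z, ν (ball z r) ∂ν ≤ 2 * (ENNReal.ofReal (2 * r) * ∫⁻ z, g z ∂ν) := by
    rw [l1, l2, ← lintegral_const_mul' _ _ (by simp)]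
    simp_rw [← lintegral_const_mul' 2 _ (by simp : (2:ENNReal) ≠ ⊤)]
    calc ∫⁻ z, ∫⁻ w, 2 * (e z w * (g z * g w))
        ≤ ∫⁻ z, ∫⁻ w, (e z w * (g z * g z) + e z w * (g w * g w)) := by
          refine lintegral_mono fun z => lintegral_mono fun w => ?_
          calc 2 * (e z w * (g z * g w)) = e z w * (2 * (g z * g w)) := by ring
            _ ≤ e z w * (g z * g z + g w * g w) := by gcongr; exact amgm _ _
            _ = _ := by ring
      _ = ∫⁻ z, (ENNReal.ofReal (2 * r) * (g z * g z) + ∫⁻ w, e z w * (g w * g w)) := by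
          refine lintegral_congr fun z => ?_
          rw [lintegral_add_left ((hemz z).mul_const _), lintegral_mul_const _ (hemz z), hb2]
      _ = (∫⁻ z, ENNReal.ofReal (2 * r) * (g z * g z)) + ∫⁻ z, ∫⁻ w, e z w * (g w * g w) := by
          rw [lintegral_add_left (hgg.const_mul _)]
      _ = (∫⁻ z, ENNReal.ofReal (2 * r) * (g z * g z)) + ∫⁻ w, ∫⁻ z, e z w * (g w * g w) := by
          congr 1
          refine lintegral_lintegral_swap ?_
          exact (hem.mul ((hg.mul hg).comp measurable_snd)).aemeasurable
      _ = (∫⁻ z, ENNReal.ofReal (2 * r) * (g z * g z)) + ∫⁻ z, ENNReal.ofReal (2 * r) * (g z * g z) := by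
          congr 1
          refine lintegral_congr fun w => ?_
          rw [lintegral_mul_const _ (hemw w), hb3]
      _ = _ := by
          rw [lintegral_const_mul _ hgg]; ring
  exact (ENNReal.mul_le_mul_iff_right (by simp) (by simp)).1 l3

lemma mo_ball {h : ℝ → ℝ} {μ : Measure ℝ} (hcont : ContinuousOn h (Set.Icc 0 1))
    (hμ : μ = (volume.restrict (Set.Icc 0 1)).withDensity fun x => ENNReal.ofReal (h x))
    {x : ℝ} (hx : x ∈ Ioo (0:ℝ) 1) :
    Tendsto (fun s => μ (ball x s) / ENNReal.ofReal (2 * s)) (𝓝[>] 0)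
      (𝓝 (ENNReal.ofReal (h x))) := by
  have hI : Icc (0:ℝ) 1 ∈ 𝓝 x := Icc_mem_nhds hx.1 hx.2
  have hc : Tendsto (fun y => ENNReal.ofReal (h y)) (𝓝 x) (𝓝 (ENNReal.ofReal (h x))) :=
    (ENNReal.continuous_ofReal.tendsto _).comp (hcont.continuousAt hI)
  have hball : ∀ s, ball x s ⊆ Icc (0:ℝ) 1 →
      μ (ball x s) = ∫⁻ y in ball x s, ENNReal.ofReal (h y) := by
    intro s hs
    rw [hμ, withDensity_apply _ measurableSet_ball, Measure.restrict_restrict measurableSet_ball,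
      inter_eq_left.2 hs]
  have hdiv0 : ∀ s : ℝ, 0 < s → ENNReal.ofReal (2 * s) ≠ 0 := by
    intro s hs; simp [hs]
  refine tendsto_order.2 ⟨fun a ha => ?_, fun a ha => ?_⟩
  · obtain ⟨a', h1, h2⟩ := exists_between ha
    obtain ⟨ε, hε, hb⟩ := Metric.mem_nhds_iff.1 (inter_mem hI (hc.eventually (lt_mem_nhds h2)))
    filter_upwards [Ioo_mem_nhdsGT hε] with s hs
    have hsub : ball x s ⊆ ball x ε := ball_subset_ball hs.2.le
    refine h1.trans_le ?_
    rw [ENNReal.le_div_iff_mul_le (Or.inl (hdiv0 s hs.1)) (Or.inl ENNReal.ofReal_ne_top),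
      hball s (fun y hy => (hb (hsub hy)).1), ← Real.volume_ball x s, ← setLIntegral_const]
    exact setLIntegral_mono' measurableSet_ball (fun y hy => le_of_lt (hb (hsub hy)).2)
  · obtain ⟨a', h1, h2⟩ := exists_between ha
    obtain ⟨ε, hε, hb⟩ := Metric.mem_nhds_iff.1 (inter_mem hI (hc.eventually (gt_mem_nhds h1)))
    filter_upwards [Ioo_mem_nhdsGT hε] with s hs
    have hsub : ball x s ⊆ ball x ε := ball_subset_ball hs.2.le
    refine lt_of_le_of_lt ?_ h2
    rw [ENNReal.div_le_iff_le_mul (Or.inl (hdiv0 s hs.1)) (Or.inl ENNReal.ofReal_ne_top),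
      hball s (fun y hy => (hb (hsub hy)).1), ← Real.volume_ball x s, ← setLIntegral_const]
    exact setLIntegral_mono' measurableSet_ball (fun y hy => le_of_lt (hb (hsub hy)).2)

lemma mo_local {μ : Measure ℝ} {x H m : ℝ} {k : ℝ → ℝ} (hm : 0 < m) 
    (hk0 : k x = 0)
    (hk : Tendsto (fun y => k y / |y - x|) (𝓝[≠] x) (𝓝 m))
    (hball : Tendsto (fun s => μ (ball x s) / ENNReal.ofReal (2 * s)) (𝓝[>] 0)
      (𝓝 (ENNReal.ofReal H))) :
    ∃ U ∈ 𝓝 x, ∀ V ∈ 𝓝 x, V ⊆ U →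
      Tendsto (fun r => μ (V ∩ {y | k y < r}) / ENNReal.ofReal (2 * r)) (𝓝[>] 0)
        (𝓝 (ENNReal.ofReal (H / m))) := by
  -- two-sided control near x
  have hlow : ∀ c, c < m → ∀ᶠ y in 𝓝 x, c * |y - x| ≤ k y := by
    intro c hc
    have h1 := hk.eventually (lt_mem_nhds hc)
    rw [eventually_nhdsWithin_iff] at h1
    filter_upwards [h1] with y hy
    by_cases hyx : y = x
    · subst hyx; simp [hk0]
    · exact ((lt_div_iff₀ (abs_pos.2 (sub_ne_zero.2 hyx))).1 (hy hyx)).le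
  have hupp : ∀ c, m < c → ∀ᶠ y in 𝓝 x, k y ≤ c * |y - x| := by
    intro c hc
    have h1 := hk.eventually (gt_mem_nhds hc)
    rw [eventually_nhdsWithin_iff] at h1
    filter_upwards [h1] with y hy
    by_cases hyx : y = x
    · subst hyx; simp [hk0]
    · exact ((div_lt_iff₀ (abs_pos.2 (sub_ne_zero.2 hyx))).1 (hy hyx)).le
  -- scaling of balls
  have hscale : ∀ c : ℝ, 0 < c →
      Tendsto (fun r => μ (ball x (r / c)) / ENNReal.ofReal (2 * r)) (𝓝[>] 0)
        (𝓝 (ENNReal.ofReal (H / c))) := by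
    intro c hc
    have h1 : Tendsto (fun r : ℝ => r / c) (𝓝[>] 0) (𝓝[>] 0) := by
      refine tendsto_nhdsWithin_iff.2 ⟨?_, ?_⟩
      · have : Tendsto (fun r : ℝ => r / c) (𝓝 0) (𝓝 (0 / c)) :=
          (continuous_id.div_const c).tendsto 0
        rw [zero_div] at this
        exact this.mono_left nhdsWithin_le_nhds
      · filter_upwards [self_mem_nhdsWithin] with r hr
        exact div_pos hr hc
    have h2 := ENNReal.Tendsto.div_const (hball.comp h1) (b := ENNReal.ofReal c)
      (Or.inr (by simpa using hc))
    rw [← ENNReal.ofReal_div_of_pos hc] at h2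
    refine h2.congr' ?_
    filter_upwards [self_mem_nhdsWithin] with r hr
    have hr : 0 < r := hr
    simp only [Function.comp]
    rw [div_eq_mul_inv, div_eq_mul_inv, div_eq_mul_inv, mul_assoc,
      ← ENNReal.mul_inv (Or.inl (by simpa using mul_pos hr (inv_pos.2 hc))) (Or.inl ENNReal.ofReal_ne_top),
      ← ENNReal.ofReal_mul (by positivity)]
    congr 3
    field_simp
  refine ⟨_, hlow (m / 2) (by linarith), fun V hV hVU => ?_⟩
  have hcontH : Tendsto (fun c : ℝ => ENNReal.ofReal (H / c)) (𝓝 m) (𝓝 (ENNReal.ofReal (H / m))) :=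
    (ENNReal.continuous_ofReal.tendsto _).comp
      (tendsto_const_nhds.div tendsto_id hm.ne')
  -- shrinking
  have hshrink : ∀ S ∈ 𝓝 x, ∀ᶠ r in 𝓝[>] (0:ℝ), ∀ y ∈ V, k y < r → y ∈ S := by
    intro S hS
    obtain ⟨ε, hε, hb⟩ := Metric.mem_nhds_iff.1 hS
    filter_upwards [Ioo_mem_nhdsGT (show 0 < m / 2 * ε by positivity)] with r hr y hy hky
    apply hb
    rw [mem_ball, Real.dist_eq]
    have : m / 2 * |y - x| ≤ k y := hVU hy
    have h3 : m / 2 * |y - x| < m / 2 * ε := by linarith [hr.2]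
    exact lt_of_mul_lt_mul_left h3 (by positivity)
  refine tendsto_order.2 ⟨fun a ha => ?_, fun a ha => ?_⟩
  · have h1 : ∀ᶠ c in 𝓝[>] m, a < ENNReal.ofReal (H / c) :=
      (hcontH.mono_left nhdsWithin_le_nhds).eventually (lt_mem_nhds ha)
    obtain ⟨c, hca, hcm⟩ := (h1.and self_mem_nhdsWithin).exists
    have hcm : m < c := hcm
    have hc : 0 < c := hm.trans hcm
    obtain ⟨ε, hε, hb⟩ := Metric.mem_nhds_iff.1 (inter_mem hV (hupp c hcm))
    filter_upwards [(hscale c hc).eventually (lt_mem_nhds hca),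
      Ioo_mem_nhdsGT (show 0 < c * ε by positivity)] with r hr hr2
    refine hr.trans_le (ENNReal.div_le_div_right (measure_mono ?_) _)
    intro y hy
    have hyd : |y - x| < r / c := by simpa [Real.dist_eq] using hy
    have hrc : r / c < ε := by rw [div_lt_iff₀ hc]; linarith [hr2.2]
    have := hb (show y ∈ ball x ε by rw [mem_ball, Real.dist_eq]; exact hyd.trans hrc)
    refine ⟨this.1, ?_⟩
    have h2 : k y ≤ c * |y - x| := this.2
    rw [lt_div_iff₀ hc] at hyd
    show k y < r
    linarith
  · have h1 : ∀ᶠ c in 𝓝[<] m, ENNReal.ofReal (H / c) < a :=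
      (hcontH.mono_left nhdsWithin_le_nhds).eventually (gt_mem_nhds ha)
    obtain ⟨c, hca, hcm⟩ := (h1.and (Ioo_mem_nhdsLT hm)).exists
    have hc : 0 < c := hcm.1
    filter_upwards [(hscale c hc).eventually (gt_mem_nhds hca),
      hshrink _ (hlow c hcm.2)] with r hr hr2
    refine lt_of_le_of_lt (ENNReal.div_le_div_right (measure_mono ?_) _) hr
    intro y hy
    have h3 : c * |y - x| ≤ k y := hr2 y hy.1 hy.2
    have h4 : k y < r := hy.2
    rw [mem_ball, Real.dist_eq, lt_div_iff₀ hc]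
    linarith

lemma mo_slope {f : ℝ → ℝ} {f' x : ℝ} (hf : HasDerivAt f f' x) :
    Tendsto (fun y => |f x - f y| / |y - x|) (𝓝[≠] x) (𝓝 |f'|) := by
  refine hf.tendsto_slope.abs.congr fun y => ?_
  rw [slope_def_field, abs_div, abs_sub_comm (f y)]

lemma mo_Dlim {f h : ℝ → ℝ} {μ : Measure ℝ} {n : ℕ} {P : Fin n → Set ℝ} (hfm : Measurable f)
    (hP : ∀ i, IsOpen (P i) ∧ (P i).OrdConnected ∧ P i ⊆ Ioo 0 1 ∧ InjOn f (P i) ∧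
        ∀ x ∈ P i, HasStrictDerivAt f (deriv f x) x ∧ deriv f x ≠ 0)
    (hμB : μ (Icc (0:ℝ) 1 \ ⋃ i, P i) = 0) (hμI : μ (Icc (0:ℝ) 1)ᶜ = 0)
    (hpos : ∀ x ∈ Set.Icc (0:ℝ) 1, 0 ≤ h x)
    (hball : ∀ x ∈ Ioo (0:ℝ) 1, Tendsto (fun s => μ (ball x s) / ENNReal.ofReal (2 * s)) (𝓝[>] 0)
      (𝓝 (ENNReal.ofReal (h x))))
    (z : ℝ) (hz : ∀ i, z ∉ frontier (f '' P i))
    (hzB : z ∉ f '' (Icc (0:ℝ) 1 \ ⋃ i, P i))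
    (hF : {y ∈ Set.Icc (0:ℝ) 1 | f y = z}.Finite) :
    Tendsto (fun r => μ {y | y ∈ Icc (0:ℝ) 1 ∧ |z - f y| < r} / ENNReal.ofReal (2 * r)) (𝓝[>] 0)
      (𝓝 (ENNReal.ofReal (∑ᶠ y ∈ {y ∈ Set.Icc (0:ℝ) 1 | f y = z}, h y / |deriv f y|))) := by
  have hgood : ∀ y ∈ {y ∈ Set.Icc (0:ℝ) 1 | f y = z}, ∃ i, y ∈ P i := by
    intro y hy
    by_contra hcon
    exact hzB ⟨y, ⟨hy.1, fun hc => hcon (mem_iUnion.1 hc)⟩, hy.2⟩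
  have hU : ∀ y, ∃ U : Set ℝ, y ∈ {y ∈ Set.Icc (0:ℝ) 1 | f y = z} → U ∈ 𝓝 y ∧
      ∀ V ∈ 𝓝 y, V ⊆ U →
      Tendsto (fun r => μ (V ∩ {y' | |z - f y'| < r}) / ENNReal.ofReal (2 * r)) (𝓝[>] 0)
        (𝓝 (ENNReal.ofReal (h y / |deriv f y|))) := by
    intro y
    by_cases hy : y ∈ {y ∈ Set.Icc (0:ℝ) 1 | f y = z}
    · obtain ⟨i, hi⟩ := hgood y hy
      obtain ⟨-, -, hs, -, hd⟩ := hP i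
      obtain ⟨U, h1, h2⟩ := mo_local (μ := μ) (x := y) (H := h y) (m := |deriv f y|)
        (k := fun y' => |z - f y'|) (abs_pos.2 (hd y hi).2) (by simp [hy.2])
        (by have := mo_slope (hd y hi).1.hasDerivAt
            rwa [hy.2] at this) (hball y (hs hi))
      exact ⟨U, fun _ => ⟨h1, h2⟩⟩
    · exact ⟨univ, fun h => absurd h hy⟩
  choose U hU using hU
  obtain ⟨O, hO, hdis⟩ := hF.t2_separation
  set V : ℝ → Set ℝ := fun y => O y ∩ interior (U y) with hVdef
  have hVo : ∀ y, IsOpen (V y) := fun y => (hO y).2.inter isOpen_interior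
  have hVn : ∀ y ∈ {y ∈ Set.Icc (0:ℝ) 1 | f y = z}, V y ∈ 𝓝 y := fun y hy =>
    (hVo y).mem_nhds ⟨(hO y).1, mem_interior_iff_mem_nhds.2 (hU y hy).1⟩
  have hloc := mo_localize hP z hz V (fun y hy hyz => hVn y ⟨hy, hyz⟩)
  have hnn : ∀ y ∈ hF.toFinset, 0 ≤ h y / |deriv f y| := by
    intro y hy
    rw [Set.Finite.mem_toFinset] at hy
    exact div_nonneg (hpos y hy.1) (abs_nonneg _)
  rw [finsum_mem_eq_finite_toFinset_sum _ hF, ENNReal.ofReal_sum_of_nonneg hnn]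
  have hlim := tendsto_finsetSum hF.toFinset (fun y hy =>
    (hU y (hF.mem_toFinset.1 hy)).2 (V y) (hVn y (hF.mem_toFinset.1 hy))
      (inter_subset_right.trans interior_subset))
  refine hlim.congr' ?_
  filter_upwards [hloc] with r hr
  have hmk : MeasurableSet {y' | |z - f y'| < r} :=
    measurableSet_lt ((measurable_const.sub hfm).abs) measurable_const
  simp only [div_eq_mul_inv]
  rw [← Finset.sum_mul, ← measure_biUnion_finset (f := fun y => V y ∩ {y' | |z - f y'| < r})]
  · congr 1
    refine le_antisymm ?_ ?_
    · refine (measure_mono (t := {y | y ∈ Icc (0:ℝ) 1 ∧ |z - f y| < r} ∪ (Icc (0:ℝ) 1)ᶜ) ?_).trans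
        ((measure_union_le _ _).trans (by rw [hμI, add_zero]))
      intro y' hy'
      simp only [mem_iUnion] at hy'
      obtain ⟨y, -, hy2⟩ := hy'
      by_cases hI : y' ∈ Icc (0:ℝ) 1
      · left; exact ⟨hI, hy2.2⟩
      · right; exact hI
    · refine (measure_mono (t := (⋃ y ∈ hF.toFinset, V y ∩ {y' | |z - f y'| < r}) ∪
        (Icc (0:ℝ) 1 \ ⋃ i, P i)) ?_).trans
        ((measure_union_le _ _).trans (by rw [hμB, add_zero]))
      intro y' hy'
      by_cases hI : y' ∈ ⋃ i, P i
      · left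
        obtain ⟨y, hy, hyz, hyV⟩ := hr y' hI hy'.2
        simp only [mem_iUnion]
        exact ⟨y, hF.mem_toFinset.2 ⟨hy, hyz⟩, hyV, hy'.2⟩
      · right; exact ⟨hy'.1, hI⟩
  · intro a ha b hb hab
    have := hdis (by simpa using ha) (by simpa using hb) hab
    exact this.mono (inter_subset_left.trans inter_subset_left)
      (inter_subset_left.trans inter_subset_left)
  · intro y _
    exact (hVo y).measurableSet.inter hmk

lemma mo_Ulim {f T h : ℝ → ℝ} {μ : Measure ℝ} {n : ℕ} {P : Fin n → Set ℝ}
    (hP : ∀ i, IsOpen (P i) ∧ (P i).OrdConnected ∧ P i ⊆ Ioo 0 1 ∧ InjOn f (P i) ∧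
        ∀ x ∈ P i, HasStrictDerivAt f (deriv f x) x ∧ deriv f x ≠ 0)
    (hμB : μ (Icc (0:ℝ) 1 \ ⋃ i, P i) = 0) (hμI : μ (Icc (0:ℝ) 1)ᶜ = 0)
    (hball : ∀ x ∈ Ioo (0:ℝ) 1, Tendsto (fun s => μ (ball x s) / ENNReal.ofReal (2 * s)) (𝓝[>] 0)
      (𝓝 (ENNReal.ofReal (h x))))
    (x : ℝ) (hz : ∀ i, f x ∉ frontier (f '' P i))
    (hx : x ∈ ⋃ i, P i)
    (hF : {y ∈ Set.Icc (0:ℝ) 1 | f y = f x}.Finite)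
    (hdiff : DifferentiableAt ℝ (f ∘ T) x)
    (hsep : ∀ y ∈ Icc (0:ℝ) 1, f y = f x → y ≠ x → ContinuousAt (f ∘ T) y ∧ f (T y) ≠ f (T x)) :
    Tendsto (fun r => μ {y | y ∈ Icc (0:ℝ) 1 ∧ |f x - f y| < r ∧ |f (T x) - f (T y)| < r}
        / ENNReal.ofReal (2 * r)) (𝓝[>] 0)
      (𝓝 (ENNReal.ofReal (h x / max |deriv f x| |deriv (f ∘ T) x|))) := by
  obtain ⟨i, hi⟩ := mem_iUnion.1 hx
  obtain ⟨-, -, hs, -, hd⟩ := hP i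
  obtain ⟨U, h1, h2⟩ := mo_local (μ := μ) (x := x) (H := h x)
    (m := max |deriv f x| |deriv (f ∘ T) x|)
    (k := fun y' => max |f x - f y'| |f (T x) - f (T y')|)
    (lt_max_of_lt_left (abs_pos.2 (hd x hi).2)) (by simp)
    (by
      refine ((mo_slope (hd x hi).1.hasDerivAt).max (mo_slope hdiff.hasDerivAt)).congr fun y => ?_
      rw [← max_div_div_right (abs_nonneg _)]; rfl) (hball x (hs hi))
  refine (h2 U h1 subset_rfl).congr' ?_
  have hloc := mo_localize hP (f x) hz
    (fun y => if y = x then U else {y' | |f (T x) - f (T y)| / 2 < |f (T x) - f (T y')|}) (by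
      intro y hy hyx
      by_cases h : y = x
      · simp only [h, if_true]; exact h1
      · simp only [h, if_false]
        obtain ⟨hc, hne⟩ := hsep y hy hyx h
        have hp : 0 < |f (T x) - f (T y)| := abs_pos.2 (sub_ne_zero.2 hne.symm)
        have : Tendsto (fun y' => |f (T x) - f (T y')|) (𝓝 y) (𝓝 |f (T x) - f (T y)|) :=
          (tendsto_const_nhds.sub hc.tendsto).abs
        exact this.eventually (lt_mem_nhds (half_lt_self hp)))
  have hsmall : ∀ᶠ r in 𝓝[>] (0:ℝ), ∀ y ∈ {y ∈ Set.Icc (0:ℝ) 1 | f y = f x}, y ≠ x →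
      r < |f (T x) - f (T y)| / 2 := by
    rw [eventually_all_finite hF]
    intro y hy
    by_cases h : y = x
    · simp [h]
    · have hp : 0 < |f (T x) - f (T y)| / 2 :=
        half_pos (abs_pos.2 (sub_ne_zero.2 (hsep y hy.1 hy.2 h).2.symm))
      filter_upwards [Ioo_mem_nhdsGT hp] with r hr _ using hr.2
  filter_upwards [hloc, hsmall] with r hr hr2
  congr 1
  refine le_antisymm ?_ ?_
  · refine (measure_mono (t := {y | y ∈ Icc (0:ℝ) 1 ∧ |f x - f y| < r ∧ |f (T x) - f (T y)| < r}
      ∪ (Icc (0:ℝ) 1)ᶜ) ?_).trans ((measure_union_le _ _).trans (by rw [hμI, add_zero]))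
    intro y' hy'
    by_cases hI : y' ∈ Icc (0:ℝ) 1
    · left; exact ⟨hI, max_lt_iff.1 hy'.2⟩
    · right; exact hI
  · refine (measure_mono (t := (U ∩ {y' | max |f x - f y'| |f (T x) - f (T y')| < r}) ∪
        (Icc (0:ℝ) 1 \ ⋃ i, P i)) ?_).trans
        ((measure_union_le _ _).trans (by rw [hμB, add_zero]))
    intro y' hy'
    by_cases hI : y' ∈ ⋃ i, P i
    · left
      obtain ⟨y, hy, hyz, hyV⟩ := hr y' hI hy'.2.1
      by_cases h : y = x
      · simp only [h, if_true] at hyV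
        exact ⟨hyV, max_lt hy'.2.1 hy'.2.2⟩
      · simp only [h, if_false] at hyV
        have a := hr2 y ⟨hy, hyz⟩ h
        have b := hy'.2.2
        have c : |f (T x) - f (T y)| / 2 < |f (T x) - f (T y')| := hyV
        linarith
    · right; exact ⟨hy'.1, hI⟩

lemma mo_sep {f T : ℝ → ℝ} {μ : Measure ℝ} [IsProbabilityMeasure μ]
    {n : ℕ} {P : Fin n → Set ℝ} (hfm : Measurable f) (hTm : Measurable T)
    (hP : ∀ i, IsOpen (P i) ∧ (P i).OrdConnected ∧ P i ⊆ Ioo 0 1 ∧ InjOn f (P i) ∧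
        ∀ x ∈ P i, HasStrictDerivAt f (deriv f x) x ∧ deriv f x ≠ 0)
    (hA0 : μ {x ∈ Set.Icc (0:ℝ) 1 |
        {y ∈ Set.Icc (0:ℝ) 1 | f y = f x ∧ f (T y) = f (T x)} = {x}} = 1) :
    ∀ᵐ x ∂μ, x ∈ ⋃ i, P i → ∀ y ∈ ⋃ i, P i, f y = f x → f (T y) = f (T x) → y = x := by
  set G : Fin n → Fin n → Set (ℝ × ℝ) := fun i j =>
    {p | p.1 ∈ P i ∧ p.2 ∈ P j ∧ p.2 ≠ p.1 ∧ f p.2 = f p.1 ∧ f (T p.2) = f (T p.1)} with hG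
  have hfT : Measurable (fun x => f (T x)) := hfm.comp hTm
  have hGm : ∀ i j, MeasurableSet (G i j) := by
    intro i j
    refine MeasurableSet.inter (measurable_fst (hP i).1.measurableSet) ?_
    refine MeasurableSet.inter (measurable_snd (hP j).1.measurableSet) ?_
    refine MeasurableSet.inter (measurableSet_eq_fun measurable_snd measurable_fst).compl ?_
    refine MeasurableSet.inter
      (measurableSet_eq_fun (hfm.comp measurable_snd) (hfm.comp measurable_fst)) ?_
    exact measurableSet_eq_fun (hfT.comp measurable_snd) (hfT.comp measurable_fst)
  have hinj : ∀ i j, InjOn Prod.fst (G i j) := by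
    rintro i j ⟨a, b⟩ h1 ⟨a', b'⟩ h2 he
    simp only at he
    subst he
    have : b = b' := (hP j).2.2.2.1 h1.2.1 h2.2.1 (h1.2.2.2.1.trans h2.2.2.2.1.symm)
    rw [this]
  set C : Set ℝ := ⋃ i, ⋃ j, Prod.fst '' G i j with hC
  have hCm : MeasurableSet C := MeasurableSet.iUnion fun i => MeasurableSet.iUnion fun j =>
    (hGm i j).image_of_continuousOn_injOn continuous_fst.continuousOn (hinj i j)
  have hC0 : μ C = 0 := by
    rw [← prob_compl_eq_one_iff hCm]
    refine le_antisymm prob_le_one (hA0 ▸ measure_mono ?_)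
    rintro x ⟨hx, hxs⟩ hxC
    simp only [hC, mem_iUnion] at hxC
    obtain ⟨i, j, ⟨a, b⟩, h, rfl⟩ := hxC
    have : b ∈ {y ∈ Set.Icc (0:ℝ) 1 | f y = f a ∧ f (T y) = f (T a)} :=
      ⟨Ioo_subset_Icc_self ((hP j).2.2.1 h.2.1), h.2.2.2⟩
    rw [show {y ∈ Set.Icc (0:ℝ) 1 | f y = f a ∧ f (T y) = f (T a)} = {a} from hxs] at this
    exact h.2.2.1 this
  filter_upwards [measure_eq_zero_iff_ae_notMem.1 hC0] with x hx hxP y hy h1 h2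
  by_contra hne
  obtain ⟨i, hi⟩ := mem_iUnion.1 hxP
  obtain ⟨j, hj⟩ := mem_iUnion.1 hy
  exact hx (mem_iUnion.2 ⟨i, mem_iUnion.2 ⟨j, (x, y), ⟨hi, hj, hne, h1, h2⟩, rfl⟩⟩)

lemma mo_dens {h φ : ℝ → ℝ} {μ : Measure ℝ} (hcont : ContinuousOn h (Set.Icc 0 1))
    (hpos : ∀ x ∈ Set.Icc (0:ℝ) 1, 0 ≤ h x)
    (hμ : μ = (volume.restrict (Set.Icc 0 1)).withDensity fun x => ENNReal.ofReal (h x)) :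
    ∫⁻ x, ENNReal.ofReal (φ x) ∂μ = ∫⁻ x in Icc (0:ℝ) 1, ENNReal.ofReal (φ x * h x) := by
  rw [hμ, lintegral_withDensity_eq_lintegral_mul_non_measurable₀ _
    (hcont.aemeasurable measurableSet_Icc).ennreal_ofReal (by simp)]
  refine setLIntegral_congr_fun measurableSet_Icc fun x hx => ?_
  simp only [Pi.mul_apply]
  rw [mul_comm (φ x), ENNReal.ofReal_mul (hpos x hx)]

/-- Under the assumption `A₀(x) = {x}` a.e., the limit
`p_{0,2} = lim_{r→0} (μ⊗μ)(S_r ∩ (T×T)⁻¹ S_r)/(μ⊗μ)(S_r)` exists and equals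
`[∫_I h²/max(|f'|,|(f∘T)'|) dx] / [∫_I (Σ_{y ∈ f⁻¹{f(x)}} h(y)/|f'(y)|) h(x) dx]`. -/
theorem matching_observations_p0
    (T h f : ℝ → ℝ)
    (hTmeas : Measurable T) (hTmaps : Set.MapsTo T (Set.Icc 0 1) (Set.Icc 0 1))
    (hTpc : PiecewiseC1On T 0 1)
    (hTexp : ∀ x ∈ Set.Icc (0:ℝ) 1, DifferentiableAt ℝ T x → 1 < |deriv T x|)
    (hcont : ContinuousOn h (Set.Icc 0 1))
    (hpos : ∀ x ∈ Set.Icc (0:ℝ) 1, 0 ≤ h x)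
    (μ : Measure ℝ)
    (hμ : μ = (volume.restrict (Set.Icc 0 1)).withDensity fun x => ENNReal.ofReal (h x))
    (hprob : IsProbabilityMeasure μ)
    (hinv : μ.map T = μ)
    (hfmeas : Measurable f)
    (hfpc : PiecewiseC1On f 0 1)
    (hf' : ∀ x ∈ Set.Icc (0:ℝ) 1, DifferentiableAt ℝ f x → deriv f x ≠ 0)
    (hfin : ∀ x ∈ Set.Icc (0:ℝ) 1, {y ∈ Set.Icc (0:ℝ) 1 | f y = f x}.Finite)
    (hA0 : μ {x ∈ Set.Icc (0:ℝ) 1 |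
        {y ∈ Set.Icc (0:ℝ) 1 | f y = f x ∧ f (T y) = f (T x)} = {x}} = 1)
    (hdenom : ∫ x in Set.Icc (0:ℝ) 1,
        (∑ᶠ y ∈ {y ∈ Set.Icc (0:ℝ) 1 | f y = f x}, h y / |deriv f y|) * h x ≠ 0) :
    Tendsto
      (fun r : ℝ =>
        ((μ.prod μ) (pairSet f r ∩
            (fun p : ℝ × ℝ => (T p.1, T p.2)) ⁻¹' pairSet f r)).toReal /
          ((μ.prod μ) (pairSet f r)).toReal)
      (𝓝[>] 0)
      (𝓝 ((∫ x in Set.Icc (0:ℝ) 1, h x ^ 2 / max |deriv f x| |deriv (f ∘ T) x|) /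
          (∫ x in Set.Icc (0:ℝ) 1,
            (∑ᶠ y ∈ {y ∈ Set.Icc (0:ℝ) 1 | f y = f x}, h y / |deriv f y|) * h x))) := by
  obtain ⟨n, P, hP, hB⟩ := mo_pieces hfpc hf'
  obtain ⟨n', Q, hQ, hBT⟩ := mo_pieces hTpc (fun x hx hd h0 => by
    have := hTexp x hx hd
    rw [h0, abs_zero] at this
    linarith)
  have hμac : μ ≪ volume := by
    rw [hμ]
    exact (withDensity_absolutelyContinuous _ _).trans Measure.absolutelyContinuous_restrict
  have hμI : μ (Icc (0:ℝ) 1)ᶜ = 0 := by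
    rw [hμ]
    refine withDensity_absolutelyContinuous _ _ ?_
    rw [Measure.restrict_apply measurableSet_Icc.compl]
    simp
  have haeI : ∀ᵐ x ∂μ, x ∈ Icc (0:ℝ) 1 := by
    rw [ae_iff]; exact hμI
  have hμB : μ (Icc (0:ℝ) 1 \ ⋃ i, P i) = 0 := hμac (hB.measure_zero _)
  set ν : Measure ℝ := μ.map f with hν
  have hνac : ν ≪ volume := by
    refine Measure.AbsolutelyContinuous.mk fun N hN h0 => ?_
    rw [hν, Measure.map_apply hfmeas hN]
    refine measure_mono_null (t := (Icc (0:ℝ) 1 ∩ f ⁻¹' N) ∪ (Icc (0:ℝ) 1)ᶜ) ?_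
      (measure_union_null (hμac (mo_preimage_null hfmeas hP hB hN h0)) hμI)
    intro x hx
    by_cases hI : x ∈ Icc (0:ℝ) 1
    · left; exact ⟨hI, hx⟩
    · right; exact hI
  have hνprob : IsProbabilityMeasure ν := Measure.isProbabilityMeasure_map hfmeas.aemeasurable
  have hpull : ∀ {p : ℝ → Prop}, (∀ᵐ z ∂(volume : Measure ℝ), p z) → ∀ᵐ x ∂μ, p (f x) :=
    fun hp => ae_of_ae_map hfmeas.aemeasurable (hνac.ae_le hp)
  -- exceptional set for `f ∘ T`
  set N : Set ℝ := (Icc (0:ℝ) 1 \ ⋃ i, Q i) ∪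
    ⋃ j, {y | y ∈ Q j ∧ T y ∈ Icc (0:ℝ) 1 \ ⋃ i, P i} with hN
  have hNfin : N.Finite := by
    refine hBT.union (Set.finite_iUnion fun j => ?_)
    refine Set.Finite.of_finite_image (f := T) (hB.subset ?_)
      ((hQ j).2.2.2.1.mono fun y hy => hy.1)
    rintro _ ⟨y, hy, rfl⟩
    exact hy.2
  have hNdiff : ∀ y ∈ Icc (0:ℝ) 1, y ∉ N → DifferentiableAt ℝ (f ∘ T) y := by
    intro y hy hyN
    have h1 : y ∈ ⋃ i, Q i := by
      by_contra hc
      exact hyN (Or.inl ⟨hy, hc⟩)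
    obtain ⟨j, hj⟩ := mem_iUnion.1 h1
    have h2 : T y ∈ ⋃ i, P i := by
      by_contra hc
      exact hyN (Or.inr (mem_iUnion.2 ⟨j, hj, hTmaps hy, hc⟩))
    obtain ⟨i, hi⟩ := mem_iUnion.1 h2
    exact (((hP i).2.2.2.2 _ hi).1.hasDerivAt.differentiableAt).comp y
      ((hQ j).2.2.2.2 _ hj).1.hasDerivAt.differentiableAt
  -- almost everywhere facts
  have ae1 : ∀ᵐ x ∂μ, ∀ i, f x ∉ frontier (f '' P i) := by
    rw [ae_all_iff]
    intro i
    obtain ⟨ho, hoc, hs, hinj, hd⟩ := hP i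
    have hcv : Convex ℝ (f '' P i) := by
      have : IsPreconnected (f '' P i) := hoc.isPreconnected.image _
        (fun x hx => (hd x hx).1.hasDerivAt.continuousAt.continuousWithinAt)
      exact this.ordConnected.convex
    exact hpull (measure_eq_zero_iff_ae_notMem.1 (hcv.addHaar_frontier volume))
  have ae2 : ∀ᵐ x ∂μ, f x ∉ f '' (Icc (0:ℝ) 1 \ ⋃ i, P i) :=
    hpull (measure_eq_zero_iff_ae_notMem.1 ((hB.image f).measure_zero _))
  have ae3 : ∀ᵐ x ∂μ, f x ∉ f '' N :=
    hpull (measure_eq_zero_iff_ae_notMem.1 ((hNfin.image f).measure_zero _))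
  have ae4 := mo_sep (μ := μ) hfmeas hTmeas hP hA0
  have hball := fun x (hx : x ∈ Ioo (0:ℝ) 1) => mo_ball hcont hμ hx
  -- the main quantities
  set F : ℝ → ℝ := fun x => ∑ᶠ y ∈ {y ∈ Set.Icc (0:ℝ) 1 | f y = f x}, h y / |deriv f y| with hFdef
  set M : ℝ → ℝ := fun x => h x / max |deriv f x| |deriv (f ∘ T) x| with hMdef
  set D : ℝ → ℝ → ENNReal := fun r x =>
    μ {y | y ∈ Icc (0:ℝ) 1 ∧ |f x - f y| < r} / ENNReal.ofReal (2 * r) with hDdef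
  set U : ℝ → ℝ → ENNReal := fun r x =>
    μ {y | y ∈ Icc (0:ℝ) 1 ∧ |f x - f y| < r ∧ |f (T x) - f (T y)| < r} /
      ENNReal.ofReal (2 * r) with hUdef
  have hDlim : ∀ᵐ x ∂μ, Tendsto (fun r => D r x) (𝓝[>] 0) (𝓝 (ENNReal.ofReal (F x))) := by
    filter_upwards [ae1, ae2, haeI] with x h1 h2 hI
    exact mo_Dlim hfmeas hP hμB hμI hpos hball (f x) h1 h2 (hfin x hI)
  have hUlim : ∀ᵐ x ∂μ, Tendsto (fun r => U r x) (𝓝[>] 0) (𝓝 (ENNReal.ofReal (M x))) := by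
    filter_upwards [ae1, ae2, ae3, ae4, haeI] with x h1 h2 h3 h4 hI
    have hgood : ∀ y ∈ Icc (0:ℝ) 1, f y = f x → y ∈ ⋃ i, P i := by
      intro y hy hyx
      by_contra hc
      exact h2 ⟨y, ⟨hy, hc⟩, hyx⟩
    have hd : ∀ y ∈ Icc (0:ℝ) 1, f y = f x → DifferentiableAt ℝ (f ∘ T) y :=
      fun y hy hyx => hNdiff y hy (fun hc => h3 ⟨y, hc, hyx⟩)
    refine mo_Ulim hP hμB hμI hball x h1 (hgood x hI rfl) (hfin x hI) (hd x hI rfl) ?_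
    intro y hy hyx hne
    exact ⟨(hd y hy hyx).continuousAt, fun he => hne (h4 (hgood x hI rfl) y (hgood y hy hyx) hyx he)⟩
  have hfT : Measurable (fun x => f (T x)) := hfmeas.comp hTmeas
  have hms1 : ∀ r, MeasurableSet {p : ℝ × ℝ | |f p.1 - f p.2| < r} := fun r =>
    measurableSet_lt ((hfmeas.comp measurable_fst).sub (hfmeas.comp measurable_snd)).abs
      measurable_const
  have hms2 : ∀ r, MeasurableSet {p : ℝ × ℝ | |f (T p.1) - f (T p.2)| < r} := fun r =>
    measurableSet_lt ((hfT.comp measurable_fst).sub (hfT.comp measurable_snd)).abs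
      measurable_const
  have hDm : ∀ r, Measurable (D r) := by
    intro r
    refine Measurable.div_const ?_ _
    exact measurable_measure_prodMk_left
      ((measurable_snd measurableSet_Icc).inter (hms1 r))
  have hUm : ∀ r, Measurable (U r) := by
    intro r
    refine Measurable.div_const ?_ _
    exact measurable_measure_prodMk_left
      ((measurable_snd measurableSet_Icc).inter ((hms1 r).inter (hms2 r)))
  have hUD : ∀ r x, U r x ≤ D r x := by
    intro r x
    refine ENNReal.div_le_div_right (measure_mono ?_) _
    intro y hy
    exact ⟨hy.1, hy.2.1⟩
  -- density
  set g : ℝ → ENNReal := ν.rnDeriv volume with hg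
  have hgm : Measurable g := Measure.measurable_rnDeriv _ _
  have hνg : ν = volume.withDensity g := (Measure.withDensity_rnDeriv_eq _ _ hνac).symm
  have hDν : ∀ r x, μ {y | y ∈ Icc (0:ℝ) 1 ∧ |f x - f y| < r} = ν (ball (f x) r) := by
    intro r x
    rw [hν, Measure.map_apply hfmeas measurableSet_ball]
    refine measure_congr ?_
    filter_upwards [haeI] with y hy
    refine propext ?_
    change (y ∈ Icc (0:ℝ) 1 ∧ |f x - f y| < r) ↔ dist (f y) (f x) < r
    rw [Real.dist_eq, abs_sub_comm]
    exact and_iff_right hy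
  have hgF : ∀ᵐ x ∂μ, g (f x) = ENNReal.ofReal (F x) := by
    have hbes := hpull (Besicovitch.ae_tendsto_rnDeriv ν (volume : Measure ℝ))
    filter_upwards [hbes, hDlim] with x h1 h2
    refine tendsto_nhds_unique h1 (h2.congr' ?_)
    filter_upwards [self_mem_nhdsWithin] with r hr
    have hr : 0 < r := hr
    simp only [hDdef]
    rw [hDν, Real.volume_closedBall]
    congr 1
    refine le_antisymm (measure_mono ball_subset_closedBall) ?_
    rw [← ball_union_sphere]
    refine (measure_union_le _ _).trans ?_
    rw [hνac (Measure.addHaar_sphere volume (f x) r), add_zero]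
  have hle : ∀ r, 0 < r → ∫⁻ x, D r x ∂μ ≤ ∫⁻ x, ENNReal.ofReal (F x) ∂μ := by
    intro r hr
    have hb : Measurable (fun z => ν (ball z r)) := by
      have hE : MeasurableSet {p : ℝ × ℝ | dist p.2 p.1 < r} :=
        measurableSet_lt (measurable_snd.dist measurable_fst) measurable_const
      exact measurable_measure_prodMk_left hE
    have h1 : ∫⁻ x, D r x ∂μ = (∫⁻ z, ν (ball z r) ∂ν) / ENNReal.ofReal (2 * r) := by
      simp only [hDdef, hDν, div_eq_mul_inv]
      rw [lintegral_mul_const _ (show Measurable (fun x => ν (ball (f x) r)) from hb.comp hfmeas)]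
      congr 1
      conv_rhs => rw [hν]
      rw [lintegral_map hb hfmeas]
    have h2 : ∫⁻ x, ENNReal.ofReal (F x) ∂μ = ∫⁻ z, g z ∂ν := by
      rw [← lintegral_congr_ae hgF]
      conv_rhs => rw [hν]
      rw [lintegral_map hgm hfmeas]
    rw [h1, h2]
    refine ENNReal.div_le_of_le_mul ?_
    rw [mul_comm]
    exact mo_upper hgm hνg r
  have hFnn : ∀ x, 0 ≤ F x := fun x =>
    finsum_nonneg fun y => finsum_nonneg fun hy => div_nonneg (hpos y hy.1) (abs_nonneg _)
  have hFint : Integrable (fun x => F x * h x) (volume.restrict (Icc 0 1)) := by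
    by_contra hc
    exact hdenom (integral_undef hc)
  have hFh : 0 ≤ᵐ[volume.restrict (Icc 0 1)] fun x => F x * h x := by
    rw [EventuallyLE, ae_restrict_iff' measurableSet_Icc]
    exact Eventually.of_forall fun x hx => mul_nonneg (hFnn x) (hpos x hx)
  have hFeq : ∫⁻ x, ENNReal.ofReal (F x) ∂μ =
      ENNReal.ofReal (∫ x in Icc (0:ℝ) 1, F x * h x) := by
    rw [mo_dens hcont hpos hμ, ofReal_integral_eq_lintegral_ofReal hFint hFh]
  have hFfin : ∫⁻ x, ENNReal.ofReal (F x) ∂μ ≠ ⊤ := by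
    rw [hFeq]; exact ENNReal.ofReal_ne_top
  have L1 := mo_pratt hUm hDm hUD hUlim hDlim hle hFfin
  have L2 := mo_pratt hDm hDm (fun _ _ => le_rfl) hDlim hDlim hle hFfin
  have hMfin : ∫⁻ x, ENNReal.ofReal (M x) ∂μ ≠ ⊤ := by
    refine ne_top_of_le_ne_top hFfin (le_of_tendsto L1 ?_)
    filter_upwards [self_mem_nhdsWithin] with r hr
    exact (lintegral_mono (hUD r)).trans (hle r hr)
  have hMeq : (∫⁻ x, ENNReal.ofReal (M x) ∂μ).toReal =
      ∫ x in Icc (0:ℝ) 1, h x ^ 2 / max |deriv f x| |deriv (f ∘ T) x| := by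
    rw [mo_dens hcont hpos hμ, integral_eq_lintegral_of_nonneg_ae]
    · congr 1
      refine lintegral_congr fun x => ?_
      simp only [hMdef]
      congr 1
      ring
    · exact Eventually.of_forall fun x =>
        div_nonneg (sq_nonneg _) (le_max_of_le_left (abs_nonneg _))
    · refine AEMeasurable.aestronglyMeasurable ?_
      exact ((hcont.aemeasurable measurableSet_Icc).pow_const 2).div
        ((measurable_deriv f).abs.max (measurable_deriv (f ∘ T)).abs).aemeasurable
  have hFeq' : (∫⁻ x, ENNReal.ofReal (F x) ∂μ).toReal = ∫ x in Icc (0:ℝ) 1, F x * h x := by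
    rw [hFeq, ENNReal.toReal_ofReal (integral_nonneg_of_ae hFh)]
  have R1 := (ENNReal.tendsto_toReal hMfin).comp L1
  have R2 := (ENNReal.tendsto_toReal hFfin).comp L2
  have R := R1.div R2 (by rw [hFeq']; exact hdenom)
  rw [hMeq, hFeq'] at R
  refine R.congr' ?_
  filter_upwards [self_mem_nhdsWithin] with r hr
  have hr : 0 < r := hr
  have hpm : MeasurableSet (pairSet f r) :=
    (measurable_fst measurableSet_Icc).inter ((measurable_snd measurableSet_Icc).inter (hms1 r))
  have hTT : Measurable (fun p : ℝ × ℝ => (T p.1, T p.2)) :=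
    (hTmeas.comp measurable_fst).prodMk (hTmeas.comp measurable_snd)
  have e2 : ∫⁻ x, D r x ∂μ = (μ.prod μ) (pairSet f r) / ENNReal.ofReal (2 * r) := by
    rw [Measure.prod_apply hpm]
    simp only [hDdef, div_eq_mul_inv]
    rw [lintegral_mul_const' _ _ (by simpa using hr)]
    congr 1
    refine lintegral_congr_ae ?_
    filter_upwards [haeI] with x hx
    congr 1
    ext y
    simp only [pairSet, mem_ofPred_eq, mem_preimage]
    tauto
  have e1 : ∫⁻ x, U r x ∂μ = (μ.prod μ) (pairSet f r ∩
            (fun p : ℝ × ℝ => (T p.1, T p.2)) ⁻¹' pairSet f r) / ENNReal.ofReal (2 * r) := by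
    rw [Measure.prod_apply (hpm.inter (hTT hpm))]
    simp only [hUdef, div_eq_mul_inv]
    rw [lintegral_mul_const' _ _ (by simpa using hr)]
    congr 1
    refine lintegral_congr_ae ?_
    filter_upwards [haeI] with x hx
    congr 1
    ext y
    have hTx := hTmaps hx
    have hTy := fun hy : y ∈ Icc (0:ℝ) 1 => hTmaps hy
    simp only [pairSet, mem_ofPred_eq, mem_preimage, mem_inter_iff]
    tauto
  simp only [Pi.div_apply, Function.comp]
  rw [e1, e2, ENNReal.toReal_div, ENNReal.toReal_div, div_div_div_cancel_right₀]
  rw [ENNReal.toReal_ofReal (by positivity)]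
  positivity
end

section
/- Let T : [0,1] → [0,1] be the doubling map Tx = 2x mod 1, let f : [0,1] → ℝ be defined by f(x) = 2x for 0 ≤ x ≤ 1/2 and f(x) = 3/2 − x for 1/2 < x ≤ 1, let μ be Lebesgue measure on [0,1], and fix an integer q ≥ 2. For r > 0 set S_r^q = { (x₁,…,x_q) ∈ [0,1]^q : max_{j=2,…,q} |f(x_j) − f(x₁)| < r } and T_q = T×⋯×T. Then the limit p_{0,q} = lim_{r→0} μ^⊗q( S_r^q ∩ T_q^{-1} S_r^q ) / μ^⊗q( S_r^q ) exists and equals (2 + 2^{2−q}) / (1 + 3^q); consequently, the extremal index θ_q^f = 1 − Σ_{k≥0} p_{k,q} (with all the p_{k,q}, k ≥ 1, equal to 0) equals 1 − (2 + 2^{2−q}) / (1 + 3^q). -/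
open MeasureTheory Set Filter Topology

/-- The doubling map `T x = 2x mod 1` on `[0,1]`. -/
noncomputable def doublingMap : ℝ → ℝ := fun x => Int.fract (2 * x)

/-- The observation `f(x) = 2x` on `[0,1/2]`, `f(x) = 3/2 - x` on `(1/2,1]`. -/
noncomputable def obsF : ℝ → ℝ := fun x => if x ≤ 1/2 then 2 * x else 3/2 - x

/-- `S_r^q = {(x₁,…,x_q) ∈ [0,1]^q : max_{j=2,…,q} |f(x_j) - f(x₁)| < r}`. -/
def obsSet (f : ℝ → ℝ) (q : ℕ) (hq : 2 ≤ q) (r : ℝ) : Set (Fin q → ℝ) :=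
  {x | (∀ i, x i ∈ Set.Icc (0:ℝ) 1) ∧
    ∀ j : Fin q, j ≠ ⟨0, by omega⟩ → |f (x j) - f (x ⟨0, by omega⟩)| < r}

/-- `T_q = T × ⋯ × T` (`q` times). -/
def prodMap (T : ℝ → ℝ) (q : ℕ) : (Fin q → ℝ) → (Fin q → ℝ) := fun x i => T (x i)

/-- The set whose measure appears in the numerator of `p_{k,q}`:
for `k = 0` it is `S_r^q ∩ T_q⁻¹ S_r^q`, while for `k ≥ 1` it is
`S_r^q ∩ ⋂_{i=1}^k T_q^{-i}(S_r^q)ᶜ ∩ T_q^{-(k+1)} S_r^q`. -/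
def clusterSet (f T : ℝ → ℝ) (q : ℕ) (hq : 2 ≤ q) (k : ℕ) (r : ℝ) : Set (Fin q → ℝ) :=
  obsSet f q hq r ∩
    (⋂ i ∈ Finset.Icc 1 k, (prodMap T q)^[i] ⁻¹' (obsSet f q hq r)ᶜ) ∩
    (prodMap T q)^[k+1] ⁻¹' obsSet f q hq r

lemma obsF_lo {x : ℝ} (h : x ≤ 1/2) : obsF x = 2 * x := by simp only [obsF]; rw [if_pos h]
lemma obsF_hi {x : ℝ} (h : 1/2 < x) : obsF x = 3/2 - x := by
  simp only [obsF]; rw [if_neg (not_le.mpr h)]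

lemma measurable_obsF : Measurable obsF := by
  unfold obsF
  exact Measurable.ite measurableSet_Iic (by fun_prop) (by fun_prop)

lemma measurable_doublingMap : Measurable doublingMap := by
  unfold doublingMap
  exact measurable_fract.comp (by fun_prop)

lemma fract_two_fract (y : ℝ) : Int.fract (2 * Int.fract y) = Int.fract (2 * y) := by
  rw [Int.fract_eq_fract]
  refine ⟨-2 * ⌊y⌋, ?_⟩
  rw [Int.fract]; push_cast; ring

lemma iter_doubling (m : ℕ) (x : ℝ) : doublingMap^[m+1] x = Int.fract (2^(m+1) * x) := by
  induction m with
  | zero => simp [doublingMap]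
  | succ m ih =>
    rw [Function.iterate_succ_apply', ih, doublingMap, fract_two_fract]
    congr 1; ring

lemma iter_prodMap (T : ℝ → ℝ) (q m : ℕ) (x : Fin q → ℝ) (i : Fin q) :
    (prodMap T q)^[m] x i = T^[m] (x i) := by
  induction m generalizing x with
  | zero => rfl
  | succ m ih => rw [Function.iterate_succ_apply, ih, Function.iterate_succ_apply]; rfl

/-- slope of `obsF` -/
noncomputable def slp (u : ℝ) : ℝ := if u ≤ 1/2 then 2 else -1

lemma obsF_local {u : ℝ} (hu : u ≠ 1/2) :
    ∀ᶠ v in 𝓝 u, obsF v - obsF u = slp u * (v - u) := by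
  rcases lt_or_gt_of_ne hu with h | h
  · filter_upwards [Iio_mem_nhds h] with v hv
    rw [obsF_lo (le_of_lt hv), obsF_lo h.le, slp, if_pos h.le]; ring
  · filter_upwards [Ioi_mem_nhds h] with v hv
    rw [obsF_hi hv, obsF_hi h, slp, if_neg (not_le.mpr h)]; ring

lemma irr_ne {x : ℝ} (h : Irrational x) (a : ℚ) : x ≠ a := h.ne_rat a

lemma irr_fract {x : ℝ} (h : Irrational x) (m : ℕ) : Irrational (Int.fract (2^m * x)) := by
  rw [Int.fract]
  have : Irrational (2^m * x) := by
    have := h.ratCast_mul (q := (2:ℚ)^m) (by positivity)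
    push_cast at this; exact this
  exact this.sub_intCast _

lemma fract_local {y : ℝ} (h : Irrational y) :
    ∀ᶠ z in 𝓝 y, Int.fract z - Int.fract y = z - y := by
  have h1 : (⌊y⌋ : ℝ) < y := lt_of_le_of_ne (Int.floor_le y) (fun e => h.ne_int ⌊y⌋ e.symm)
  filter_upwards [Ioo_mem_nhds h1 (Int.lt_floor_add_one y)] with z hz
  have : ⌊z⌋ = ⌊y⌋ := Int.floor_eq_iff.mpr ⟨hz.1.le, hz.2⟩
  rw [Int.fract, Int.fract, this]; ring

lemma obsT_local {x : ℝ} (h : Irrational x) (m : ℕ) :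
    ∀ᶠ z in 𝓝 x, obsF (doublingMap^[m+1] z) - obsF (doublingMap^[m+1] x)
      = slp (Int.fract (2^(m+1) * x)) * (2^(m+1) * (z - x)) := by
  have hy : Irrational (2^(m+1) * x) := by
    have := h.ratCast_mul (q := (2:ℚ)^(m+1)) (by positivity)
    push_cast at this; exact this
  have hu := irr_fract h (m+1)
  have hu2 : Int.fract (2^(m+1) * x) ≠ 1/2 := by simpa using hu.ne_rat (1/2)
  have c : Tendsto (fun z : ℝ => 2^(m+1) * z) (𝓝 x) (𝓝 (2^(m+1) * x)) :=
    (continuous_const.mul continuous_id).tendsto x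
  have e1 := fract_local hy
  have c2 : Tendsto (fun z : ℝ => Int.fract z) (𝓝 (2^(m+1) * x)) (𝓝 (Int.fract (2^(m+1) * x))) := by
    have : Tendsto (fun z : ℝ => Int.fract (2^(m+1) * x) + (z - 2^(m+1)*x)) (𝓝 (2^(m+1) * x))
        (𝓝 (Int.fract (2^(m+1) * x) + (2^(m+1) * x - 2^(m+1)*x))) :=
      (by fun_prop : Continuous fun z : ℝ => Int.fract (2^(m+1) * x) + (z - 2^(m+1)*x)).tendsto _
    rw [sub_self, add_zero] at this
    refine this.congr' ?_
    filter_upwards [e1] with z hz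
    linarith
  filter_upwards [c.eventually e1, (c2.comp c).eventually (obsF_local hu2)] with z h1 h2
  rw [iter_doubling, iter_doubling]
  simp only [Function.comp] at h2
  rw [h2, h1]; ring

lemma key_ne {x w : ℝ} (h : Irrational x) (m : ℕ) (hw : w = 3/2 - 2 * x) :
    obsF (doublingMap^[m+1] w) ≠ obsF (doublingMap^[m+1] x) := by
  rw [iter_doubling, iter_doubling]
  have hu := irr_fract h (m+1)
  have hv : Int.fract (2^(m+1) * w) = Int.fract (-2 * Int.fract (2^(m+1) * x)) := by
    rw [Int.fract_eq_fract]
    refine ⟨3 * 2^m - 2 * ⌊2^(m+1) * x⌋, ?_⟩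
    rw [Int.fract, hw]; push_cast; ring
  rw [hv]
  have h0 := Int.fract_nonneg (2^(m+1) * x)
  have h1 := Int.fract_lt_one (2^(m+1) * x)
  generalize Int.fract (2^(m+1) * x) = u at *
  have n0 : u ≠ 0 := by simpa using hu.ne_rat 0
  have n1 : u ≠ 1/2 := by simpa using hu.ne_rat (1/2)
  have n2 : u ≠ 1/4 := by simpa using hu.ne_rat (1/4)
  have n3 : u ≠ 3/4 := by simpa using hu.ne_rat (3/4)
  have n4 : u ≠ 1/3 := by simpa using hu.ne_rat (1/3)
  have n5 : u ≠ 2/3 := by simpa using hu.ne_rat (2/3)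
  have n6 : u ≠ 5/6 := by simpa using hu.ne_rat (5/6)
  have p0 : 0 < u := lt_of_le_of_ne h0 n0.symm
  rcases lt_or_gt_of_ne n1 with a | a
  · have : Int.fract (-2 * u) = 1 - 2 * u := by
      rw [Int.fract_eq_iff]; exact ⟨by linarith, by linarith, -1, by push_cast; ring⟩
    rw [this, obsF_lo a.le]
    rcases lt_or_gt_of_ne n2 with b | b
    · rw [obsF_hi (by linarith)]; intro e; linarith
    · rw [obsF_lo (by linarith)]; intro e; apply n4; linarith
  · have : Int.fract (-2 * u) = 2 - 2 * u := by
      rw [Int.fract_eq_iff]; exact ⟨by linarith, by linarith, -2, by push_cast; ring⟩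
    rw [this, obsF_hi a]
    rcases lt_or_gt_of_ne n3 with b | b
    · rw [obsF_hi (by linarith)]; intro e; apply n5; linarith
    · rw [obsF_lo (by linarith)]; intro e; apply n6; linarith

lemma partner (x : ℝ) (h : Irrational x) : ∃ w, Irrational w ∧
    (∀ m, obsF (doublingMap^[m+1] w) ≠ obsF (doublingMap^[m+1] x)) ∧
    ∀ r z, |obsF z - obsF x| < r → |z - x| < r ∨ |z - w| < r := by
  have mulirr : ∀ (a b : ℚ), a ≠ 0 → Irrational ((b:ℝ) - a * x) := fun a b ha =>
    (h.ratCast_mul ha).ratCast_sub b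
  rcases le_or_gt x (1/2) with hx | hx
  · refine ⟨3/2 - 2 * x, by simpa using mulirr 2 (3/2) (by norm_num), fun m => key_ne h m rfl, ?_⟩
    intro r z hz
    rw [obsF_lo hx] at hz
    rw [abs_lt] at hz
    rcases le_or_gt z (1/2) with hz' | hz'
    · left; rw [obsF_lo hz'] at hz; rw [abs_lt]; constructor <;> linarith
    · right; rw [obsF_hi hz'] at hz; rw [abs_lt]; constructor <;> linarith
  · have hw : Irrational (3/4 - 1/2 * x) := by simpa using mulirr (1/2) (3/4) (by norm_num)
    refine ⟨3/4 - 1/2 * x, hw, fun m => (key_ne hw m (by ring)).symm, ?_⟩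
    intro r z hz
    rw [obsF_hi hx] at hz
    rw [abs_lt] at hz
    rcases le_or_gt z (1/2) with hz' | hz'
    · right; rw [obsF_lo hz'] at hz; rw [abs_lt]; constructor <;> linarith
    · left; rw [obsF_hi hz'] at hz; rw [abs_lt]; constructor <;> linarith

lemma close_of {x : ℝ} (h : Irrational x) (m : ℕ) {P : ℝ → Prop} (hP : ∀ᶠ z in 𝓝 x, P z) :
    ∀ᶠ r in 𝓝[>] (0:ℝ), ∀ z, |obsF z - obsF x| < r →
      |obsF (doublingMap^[m+1] z) - obsF (doublingMap^[m+1] x)| < r → P z := by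
  obtain ⟨w, hw, hne, hcl⟩ := partner x h
  obtain ⟨e1, he1, H1⟩ := Metric.eventually_nhds_iff.mp hP
  obtain ⟨e2, he2, H2⟩ := Metric.eventually_nhds_iff.mp (obsT_local hw m)
  set D := |obsF (doublingMap^[m+1] w) - obsF (doublingMap^[m+1] x)| with hD
  have hDp : 0 < D := abs_pos.mpr (sub_ne_zero.mpr (hne m))
  set C := |slp (Int.fract (2^(m+1) * w)) * 2^(m+1)| with hC
  have hC0 : 0 ≤ C := abs_nonneg _
  have hd : 0 < D / (C + 1) := by positivity
  filter_upwards [Ioo_mem_nhdsGT he1, Ioo_mem_nhdsGT he2, Ioo_mem_nhdsGT hd] with r h1 h2 h3 z hz1 hz2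
  rcases hcl r z hz1 with hz | hz
  · exact H1 (by rw [Real.dist_eq]; exact hz.trans h1.2)
  · exfalso
    have := H2 (y := z) (by rw [Real.dist_eq]; exact hz.trans h2.2)
    rw [← mul_assoc] at this
    have e := congrArg abs this
    rw [abs_mul, ← hC] at e
    have t : D ≤ |obsF (doublingMap^[m+1] z) - obsF (doublingMap^[m+1] x)| +
      |obsF (doublingMap^[m+1] z) - obsF (doublingMap^[m+1] w)| := by
      have := abs_sub_le (obsF (doublingMap^[m+1] w)) (obsF (doublingMap^[m+1] z)) (obsF (doublingMap^[m+1] x))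
      rw [abs_sub_comm (obsF (doublingMap^[m+1] w)) (obsF (doublingMap^[m+1] z))] at this
      linarith
    have : C * |z - w| ≤ C * r := mul_le_mul_of_nonneg_left hz.le hC0
    have := (lt_div_iff₀ (by positivity)).mp h3.2
    nlinarith

/-- local scale -/
lemma two_le_slp (u : ℝ) : 1 ≤ |slp u| ∧ |slp u| ≤ 2 := by
  unfold slp; split_ifs <;> norm_num

lemma cluster_k {x : ℝ} (h : Irrational x) (k : ℕ) (hk : 1 ≤ k) :
    ∀ᶠ r in 𝓝[>] (0:ℝ), ∀ z, |obsF z - obsF x| < r →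
      |obsF (doublingMap^[k+1] z) - obsF (doublingMap^[k+1] x)| < r →
      |obsF (doublingMap z) - obsF (doublingMap x)| < r := by
  filter_upwards [close_of h k ((obsT_local h k).and (obsT_local h 0))] with r hr z h1 h2
  obtain ⟨a, b⟩ := hr z h1 h2
  simp only [zero_add, Function.iterate_one, pow_one] at b
  rw [b, abs_mul, abs_mul, abs_two]
  rw [a, abs_mul, abs_mul, abs_of_pos (by positivity : (0:ℝ) < 2^(k+1))] at h2
  have s1 := (two_le_slp (Int.fract (2^(k+1) * x))).1
  have s2 := (two_le_slp (Int.fract (2 * x))).2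
  have p : (2:ℝ)^2 ≤ 2^(k+1) := pow_le_pow_right₀ (by norm_num) (by omega)
  have q1 : 4 * |z - x| ≤ 2^(k+1) * |z - x| := by
    apply mul_le_mul_of_nonneg_right _ (abs_nonneg _); linarith
  have q2 : 2^(k+1) * |z - x| ≤ |slp (Int.fract (2^(k+1) * x))| * (2^(k+1) * |z - x|) :=
    le_mul_of_one_le_left (by positivity) s1
  have q3 : |slp (Int.fract (2 * x))| * (2 * |z - x|) ≤ 2 * (2 * |z - x|) :=
    mul_le_mul_of_nonneg_right s2 (by positivity)
  linarith

/-- scale for `k = 0` -/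
lemma cluster_0 {x : ℝ} (h : Irrational x) :
    ∀ᶠ r in 𝓝[>] (0:ℝ), ∀ z, (|obsF z - obsF x| < r ∧
      |obsF (doublingMap z) - obsF (doublingMap x)| < r) ↔
      |slp (Int.fract (2*x))| * (2 * |z - x|) < r := by
  have hx : x ≠ 1/2 := by simpa using h.ne_rat (1/2)
  have L := (obsF_local hx).and (obsT_local h 0)
  obtain ⟨e1, he1, H1⟩ := Metric.eventually_nhds_iff.mp L
  filter_upwards [close_of h 0 L, Ioo_mem_nhdsGT he1] with r hr hre z
  simp only [zero_add, Function.iterate_one, pow_one] at hr H1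
  have s1 := (two_le_slp (Int.fract (2 * x))).1
  constructor
  · rintro ⟨h1, h2⟩
    have := (hr z h1 h2).2
    rw [this, abs_mul, abs_mul, abs_two] at h2
    exact h2
  · intro hz
    have q2 : 2 * |z - x| ≤ |slp (Int.fract (2 * x))| * (2 * |z - x|) :=
      le_mul_of_one_le_left (by positivity) s1
    have hn := abs_nonneg (z - x)
    obtain ⟨a, b⟩ := H1 (y := z) (by rw [Real.dist_eq]; linarith [hre.2])
    rw [a, b, abs_mul, abs_mul, abs_mul, abs_two]
    refine ⟨?_, hz⟩
    have := mul_le_mul_of_nonneg_right (two_le_slp x).2 hn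
    linarith
/-- Lebesgue measure on the unit interval -/
noncomputable abbrev nu : Measure ℝ := volume.restrict (Set.Icc (0:ℝ) 1)

instance : IsProbabilityMeasure nu := ⟨by simp⟩

lemma nu_G_le (x r : ℝ) (hr : 0 < r) : nu {z | |obsF z - obsF x| < r} ≤ ENNReal.ofReal (3 * r) := by
  set y := obsF x with hy
  have sub : {z | |obsF z - y| < r} ⊆ Ioo (y/2 - r/2) (y/2 + r/2) ∪ Ioo (3/2-y-r) (3/2-y+r) := by
    intro z hz
    simp only [mem_ofPred_eq, abs_lt] at hz
    rcases le_or_gt z (1/2) with h | h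
    · left; rw [obsF_lo h] at hz; constructor <;> linarith
    · right; rw [obsF_hi h] at hz; constructor <;> linarith
  calc nu {z | |obsF z - y| < r} ≤ volume {z | |obsF z - y| < r} := Measure.restrict_apply_le _ _
    _ ≤ volume (Ioo (y/2 - r/2) (y/2 + r/2) ∪ Ioo (3/2-y-r) (3/2-y+r)) := measure_mono sub
    _ ≤ _ := measure_union_le _ _
    _ = ENNReal.ofReal (3 * r) := by
      rw [Real.volume_Ioo, Real.volume_Ioo, ← ENNReal.ofReal_add (by linarith) (by linarith)]
      congr 1; ring

lemma measurableSet_G (x r : ℝ) : MeasurableSet {z | |obsF z - obsF x| < r} :=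
  measurableSet_lt ((measurable_obsF.sub_const _).abs) measurable_const

lemma nu_G {x : ℝ} (h : Irrational x) (hx : x ∈ Icc (0:ℝ) 1) :
    ∀ᶠ r in 𝓝[>] (0:ℝ), nu {z | |obsF z - obsF x| < r} =
      ENNReal.ofReal ((if x ∈ Iio (1/4:ℝ) then 1 else 3) * r) := by
  have n0 : x ≠ 0 := by simpa using h.ne_rat 0
  have n1 : x ≠ 1/2 := by simpa using h.ne_rat (1/2)
  have n2 : x ≠ 1/4 := by simpa using h.ne_rat (1/4)
  have n3 : x ≠ 1 := by simpa using h.ne_rat 1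
  have p0 : 0 < x := lt_of_le_of_ne hx.1 n0.symm
  have p1 : x < 1 := lt_of_le_of_ne hx.2 n3
  rcases lt_or_gt_of_ne n2 with a | a
  · rw [if_pos (mem_Iio.mpr a)]
    have ha : 0 < 1/2 - 2 * x := by linarith
    filter_upwards [Ioo_mem_nhdsGT p0, Ioo_mem_nhdsGT ha] with r h1 h2
    have h1' := h1.2
    have h2' := h2.2
    have h0 := h1.1
    rw [Measure.restrict_apply (measurableSet_G x r)]
    have : {z | |obsF z - obsF x| < r} ∩ Icc 0 1 = Ioo (x - r/2) (x + r/2) := by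
      ext z
      simp only [mem_inter_iff, mem_ofPred_eq, mem_Icc, mem_Ioo, abs_lt]
      rw [obsF_lo (by linarith : x ≤ 1/2)]
      rcases le_or_gt z (1/2) with hz | hz
      · rw [obsF_lo hz]
        constructor
        · rintro ⟨⟨_, _⟩, _, _⟩; constructor <;> linarith
        · rintro ⟨_, _⟩; refine ⟨⟨?_, ?_⟩, ?_, ?_⟩ <;> linarith
      · rw [obsF_hi hz]
        constructor
        · rintro ⟨⟨_, _⟩, _, _⟩; constructor <;> linarith
        · rintro ⟨_, _⟩; refine ⟨⟨?_, ?_⟩, ?_, ?_⟩ <;> linarith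
    rw [this, Real.volume_Ioo]; congr 1; ring
  · rw [if_neg (by simp only [mem_Iio]; linarith)]
    have hy : 1/2 < obsF x ∧ obsF x < 1 := by
      rcases lt_or_gt_of_ne n1 with b | b
      · rw [obsF_lo b.le]; constructor <;> linarith
      · rw [obsF_hi b]; constructor <;> linarith
    set y := obsF x with hyd
    have ha : 0 < y - 1/2 := by linarith
    have hb : 0 < 1 - y := by linarith
    filter_upwards [Ioo_mem_nhdsGT ha, Ioo_mem_nhdsGT hb] with r h1 h2
    have h1' := h1.2
    have h2' := h2.2
    have h0 := h1.1
    rw [Measure.restrict_apply (measurableSet_G x r)]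
    have : {z | |obsF z - y| < r} ∩ Icc 0 1 =
        Ioo (y/2 - r/2) (y/2 + r/2) ∪ Ioo (3/2-y-r) (3/2-y+r) := by
      ext z
      simp only [mem_inter_iff, mem_union, mem_ofPred_eq, mem_Icc, mem_Ioo, abs_lt]
      rcases le_or_gt z (1/2) with hz | hz
      · rw [obsF_lo hz]
        constructor
        · rintro ⟨⟨_, _⟩, _, _⟩; left; constructor <;> linarith
        · rintro (⟨_, _⟩ | ⟨_, _⟩) <;> refine ⟨⟨?_, ?_⟩, ?_, ?_⟩ <;> linarith
      · rw [obsF_hi hz]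
        constructor
        · rintro ⟨⟨_, _⟩, _, _⟩; right; constructor <;> linarith
        · rintro (⟨_, _⟩ | ⟨_, _⟩) <;> refine ⟨⟨?_, ?_⟩, ?_, ?_⟩ <;> linarith
    rw [this, measure_union _ measurableSet_Ioo, Real.volume_Ioo, Real.volume_Ioo,
      ← ENNReal.ofReal_add (by linarith) (by linarith)]
    · congr 1; ring
    · rw [Set.disjoint_left]
      rintro z ⟨_, _⟩ ⟨_, _⟩
      linarith

lemma nu_N {x : ℝ} (h : Irrational x) (hx : x ∈ Icc (0:ℝ) 1) :
    ∀ᶠ r in 𝓝[>] (0:ℝ), nu {z | |obsF z - obsF x| < r ∧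
        |obsF (doublingMap z) - obsF (doublingMap x)| < r} =
      ENNReal.ofReal ((if x ∈ Ico (0:ℝ) (1/4) ∪ Ico (1/2) (3/4) then 1/2 else 1) * r) := by
  have n0 : x ≠ 0 := by simpa using h.ne_rat 0
  have n1 : x ≠ 1/2 := by simpa using h.ne_rat (1/2)
  have n2 : x ≠ 1/4 := by simpa using h.ne_rat (1/4)
  have n4 : x ≠ 3/4 := by simpa using h.ne_rat (3/4)
  have n3 : x ≠ 1 := by simpa using h.ne_rat 1
  have p0 : 0 < x := lt_of_le_of_ne hx.1 n0.symm
  have p1 : x < 1 := lt_of_le_of_ne hx.2 n3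
  have p2 : 0 < 1 - x := by linarith
  have hs : (if x ∈ Ico (0:ℝ) (1/4) ∪ Ico (1/2) (3/4) then (1/2:ℝ) else 1)
      = 1 / |slp (Int.fract (2*x))| := by
    have f1 : x < 1/2 → Int.fract (2*x) = 2 * x := fun a => by
      rw [Int.fract_eq_iff]; exact ⟨by linarith, by linarith, 0, by push_cast; ring⟩
    have f2 : 1/2 < x → Int.fract (2*x) = 2 * x - 1 := fun a => by
      rw [Int.fract_eq_iff]; exact ⟨by linarith, by linarith, 1, by push_cast; ring⟩
    rcases lt_or_gt_of_ne n1 with a | a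
    · rw [f1 a]
      rcases lt_or_gt_of_ne n2 with b | b
      · rw [if_pos (mem_union_left _ (mem_Ico.mpr ⟨p0.le, b⟩)), slp, if_pos (by linarith)]; norm_num
      · rw [if_neg, slp, if_neg (by linarith)]
        · norm_num
        · rintro (⟨_, _⟩ | ⟨_, _⟩) <;> linarith
    · rw [f2 a]
      rcases lt_or_gt_of_ne n4 with b | b
      · rw [if_pos (mem_union_right _ (mem_Ico.mpr ⟨a.le, b⟩)), slp, if_pos (by linarith)]; norm_num
      · rw [if_neg, slp, if_neg (by linarith)]
        · norm_num
        · rintro (⟨_, _⟩ | ⟨_, _⟩) <;> linarith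
  rw [hs]
  filter_upwards [cluster_0 h, Ioo_mem_nhdsGT p0, Ioo_mem_nhdsGT p2] with r hr h1 h2
  have h1' := h1.2
  have h2' := h2.2
  have h0 := h1.1
  set c := |slp (Int.fract (2*x))| with hc
  have c1 : 1 ≤ c := (two_le_slp _).1
  have hrc : r / (2*c) ≤ r := by
    rw [div_le_iff₀ (by linarith)]; nlinarith
  have : {z | |obsF z - obsF x| < r ∧ |obsF (doublingMap z) - obsF (doublingMap x)| < r} =
      Ioo (x - r/(2*c)) (x + r/(2*c)) := by
    ext z
    rw [mem_ofPred_eq, hr z, ← mul_assoc, mul_comm c 2, mul_comm, ← lt_div_iff₀ (by linarith), abs_lt]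
    constructor
    · rintro ⟨_, _⟩; constructor <;> linarith
    · rintro ⟨_, _⟩; constructor <;> linarith
  rw [this, Measure.restrict_apply measurableSet_Ioo, inter_eq_left.mpr, Real.volume_Ioo]
  · congr 1; field_simp; ring
  · rintro z ⟨_, _⟩; constructor <;> linarith

lemma cons_eq (n : ℕ) (x : ℝ) (y : Fin n → ℝ) :
    (MeasurableEquiv.piFinSuccAbove (fun _ : Fin (n+1) => ℝ) 0).symm (x, y) = Fin.cons x y := by
  ext i
  refine Fin.cases ?_ (fun j => ?_) i <;> simp [MeasurableEquiv.piFinSuccAbove]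

lemma slice_eq (n : ℕ) (B : Set (Fin (n+1) → ℝ)) (x : ℝ) :
    Prod.mk x ⁻¹' ((MeasurableEquiv.piFinSuccAbove (fun _ : Fin (n+1) => ℝ) 0).symm ⁻¹' B) =
      {y | Fin.cons x y ∈ B} := by
  ext y
  rw [mem_preimage, mem_preimage, cons_eq, mem_ofPred_eq]

lemma pi_slice (n : ℕ) {B : Set (Fin (n+1) → ℝ)} (hB : MeasurableSet B) :
    (Measure.pi fun _ : Fin (n+1) => nu) B =
      ∫⁻ x, (Measure.pi fun _ : Fin n => nu) {y | Fin.cons x y ∈ B} ∂nu := by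
  have mp := (measurePreserving_piFinSuccAbove (fun _ : Fin (n+1) => nu) 0).symm
  rw [← mp.measure_preimage hB.nullMeasurableSet, Measure.prod_apply]
  · simp_rw [← slice_eq]
  · exact (MeasurableEquiv.measurable _) hB

lemma slice_measurable (n : ℕ) {B : Set (Fin (n+1) → ℝ)} (hB : MeasurableSet B) :
    Measurable fun x => (Measure.pi fun _ : Fin n => nu) {y | Fin.cons x y ∈ B} := by
  have := (MeasurableEquiv.piFinSuccAbove (fun _ : Fin (n+1) => ℝ) 0).symm.measurable hB
  have := measurable_measure_prodMk_left (ν := Measure.pi fun _ : Fin n => nu) this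
  simp_rw [← slice_eq]
  exact this

lemma ae_irr : ∀ᵐ x ∂nu, Irrational x ∧ x ∈ Icc (0:ℝ) 1 := by
  have h1 : ∀ᵐ x ∂nu, x ∈ Icc (0:ℝ) 1 := ae_restrict_mem measurableSet_Icc
  have h2 : ∀ᵐ x ∂nu, x ∉ range ((↑) : ℚ → ℝ) := (countable_range _).ae_notMem _
  filter_upwards [h1, h2] with x a b using ⟨b, a⟩

lemma dct (n : ℕ) (hq : 2 ≤ n + 1) (B : ℝ → Set (Fin (n+1) → ℝ)) (hB : ∀ r, MeasurableSet (B r))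
    (hsub : ∀ r, B r ⊆ obsSet obsF (n+1) hq r) (L : ℝ → ENNReal) 
    (hlim : ∀ x, Irrational x → x ∈ Icc (0:ℝ) 1 → ∀ᶠ r in 𝓝[>] (0:ℝ),
      (Measure.pi fun _ : Fin n => nu) {y | Fin.cons x y ∈ B r} = L x * ENNReal.ofReal r ^ n) :
    Tendsto (fun r => (Measure.pi fun _ : Fin (n+1) => nu) (B r) / ENNReal.ofReal r ^ n)
      (𝓝[>] 0) (𝓝 (∫⁻ x, L x ∂nu)) := by
  have e : ∀ r, (Measure.pi fun _ : Fin (n+1) => nu) (B r) / ENNReal.ofReal r ^ n =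
      ∫⁻ x, (Measure.pi fun _ : Fin n => nu) {y | Fin.cons x y ∈ B r} / ENNReal.ofReal r ^ n ∂nu := by
    intro r
    simp only [div_eq_mul_inv]
    rw [lintegral_mul_const _ (slice_measurable n (hB r)), pi_slice n (hB r)]
  simp_rw [e]
  have nz : ∀ r : ℝ, 0 < r → ENNReal.ofReal r ^ n ≠ 0 := fun r hr =>
    pow_ne_zero _ (by simpa using hr)
  have nt : ∀ r : ℝ, ENNReal.ofReal r ^ n ≠ ⊤ := fun r => ENNReal.pow_ne_top ENNReal.ofReal_ne_top
  apply tendsto_lintegral_filter_of_dominated_convergence (fun _ => ENNReal.ofReal 3 ^ n)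
  · exact Eventually.of_forall fun r => (slice_measurable n (hB r)).div_const _
  · filter_upwards [self_mem_nhdsWithin] with r hr
    refine Eventually.of_forall fun x => ?_
    rw [ENNReal.div_le_iff (nz r hr) (nt r), ← mul_pow, ← ENNReal.ofReal_mul (by norm_num)]
    calc (Measure.pi fun _ : Fin n => nu) {y | Fin.cons x y ∈ B r}
        ≤ (Measure.pi fun _ : Fin n => nu) (univ.pi fun _ => {z | |obsF z - obsF x| < r}) := by
          apply measure_mono
          intro y hy j _
          exact (hsub r hy).2 j.succ (Fin.succ_ne_zero j)
      _ = nu {z | |obsF z - obsF x| < r} ^ n := by rw [Measure.pi_pi]; simp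
      _ ≤ _ := by gcongr; exact nu_G_le x r hr
  · rw [lintegral_const]; simp
  · filter_upwards [ae_irr] with x hx
    apply tendsto_const_nhds.congr'
    filter_upwards [hlim x hx.1 hx.2, self_mem_nhdsWithin] with r hr hr0
    rw [hr, ENNReal.mul_div_cancel_right (nz r hr0) (nt r)]

lemma int_step (S : Set ℝ) (hS : MeasurableSet S) (s a b : ℝ) (ha : 0 ≤ a) (hb : 0 ≤ b)
    (hs : nu S = ENNReal.ofReal s) (hs0 : 0 ≤ s) (hs1 : s ≤ 1) (n : ℕ) :
    ∫⁻ x, ENNReal.ofReal (open Classical in if x ∈ S then a else b) ^ n ∂nu =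
      ENNReal.ofReal (a^n * s + b^n * (1 - s)) := by
  classical
  rw [← lintegral_add_compl _ hS,
    setLIntegral_congr_fun (g := fun _ => ENNReal.ofReal a ^ n) hS (fun x hx => by simp [hx]),
    setLIntegral_congr_fun (g := fun _ => ENNReal.ofReal b ^ n) hS.compl
      (fun x hx => by simp only [mem_compl_iff] at hx; simp [hx])]
  rw [setLIntegral_const, setLIntegral_const, prob_compl_eq_one_sub hS, hs,
    ← ENNReal.ofReal_one, ← ENNReal.ofReal_sub _ hs0, ← ENNReal.ofReal_pow ha,
    ← ENNReal.ofReal_pow hb, ← ENNReal.ofReal_mul (by positivity), ← ENNReal.ofReal_mul (by positivity),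
    ← ENNReal.ofReal_add (by positivity) (mul_nonneg (by positivity) (by linarith))]

lemma measurableSet_obsSet (q : ℕ) (hq : 2 ≤ q) (r : ℝ) : MeasurableSet (obsSet obsF q hq r) := by
  have : obsSet obsF q hq r = (⋂ i, {x : Fin q → ℝ | x i ∈ Icc (0:ℝ) 1}) ∩
    ⋂ (j : Fin q) (_ : j ≠ ⟨0, by omega⟩), {x | |obsF (x j) - obsF (x ⟨0, by omega⟩)| < r} := by
    ext x; simp [obsSet]
  rw [this]
  refine MeasurableSet.inter (MeasurableSet.iInter fun i => measurable_pi_apply i measurableSet_Icc)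
    (MeasurableSet.iInter fun j => MeasurableSet.iInter fun _ => ?_)
  exact measurableSet_lt ((measurable_obsF.comp (measurable_pi_apply j)).sub
    (measurable_obsF.comp (measurable_pi_apply _))).abs measurable_const

lemma measurableSet_clusterSet (q : ℕ) (hq : 2 ≤ q) (k : ℕ) (r : ℝ) :
    MeasurableSet (clusterSet obsF doublingMap q hq k r) := by
  have hp : Measurable (prodMap doublingMap q) :=
    measurable_pi_lambda _ fun i => measurable_doublingMap.comp (measurable_pi_apply i)
  have ho := measurableSet_obsSet q hq r
  refine MeasurableSet.inter (MeasurableSet.inter ho ?_) (hp.iterate _ ho)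
  exact Finset.measurableSet_biInter _ fun i _ => hp.iterate i ho.compl

lemma doubling_mem (x : ℝ) : doublingMap x ∈ Icc (0:ℝ) 1 :=
  ⟨Int.fract_nonneg _, (Int.fract_lt_one _).le⟩

lemma pi_Icc_inter (n : ℕ) (A : Set ℝ) :
    (Measure.pi fun _ : Fin n => nu) (univ.pi fun _ => Icc 0 1 ∩ A) = nu A ^ n := by
  rw [Measure.pi_pi]
  simp only [Finset.prod_const, Finset.card_univ, Fintype.card_fin]
  congr 1
  rw [inter_comm, Measure.restrict_apply' measurableSet_Icc, Measure.restrict_apply' measurableSet_Icc,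
    inter_assoc, inter_self]

lemma lim_obs (n : ℕ) (hq : 2 ≤ n + 1) :
    Tendsto (fun r => (Measure.pi fun _ : Fin (n+1) => nu) (obsSet obsF (n+1) hq r) / ENNReal.ofReal r ^ n)
      (𝓝[>] 0) (𝓝 (ENNReal.ofReal (1^n * (1/4) + 3^n * (1 - 1/4)))) := by
  have hs : nu (Iio (1/4)) = ENNReal.ofReal (1/4) := by
    rw [Measure.restrict_apply measurableSet_Iio]
    have : Iio (1/4:ℝ) ∩ Icc 0 1 = Ico 0 (1/4) := by
      ext z; simp only [mem_inter_iff, mem_Iio, mem_Icc, mem_Ico]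
      constructor
      · rintro ⟨_, _, _⟩; constructor <;> linarith
      · rintro ⟨_, _⟩; refine ⟨?_, ?_, ?_⟩ <;> linarith
    rw [this, Real.volume_Ico]; simp
  rw [← int_step (Iio (1/4)) measurableSet_Iio (1/4) 1 3 (by norm_num) (by norm_num) hs (by norm_num)
    (by norm_num) n]
  refine dct n hq _ (measurableSet_obsSet _ hq) (fun r => subset_rfl) _ ?_
  intro x h hx
  filter_upwards [nu_G h hx] with r hr
  have : {y : Fin n → ℝ | Fin.cons x y ∈ obsSet obsF (n+1) hq r} =
      univ.pi fun _ => Icc 0 1 ∩ {z | |obsF z - obsF x| < r} := by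
    ext y
    constructor
    · intro hy j _
      exact ⟨hy.1 j.succ, hy.2 j.succ (Fin.succ_ne_zero j)⟩
    · intro hy
      refine ⟨fun i => ?_, fun j hj => ?_⟩
      · exact Fin.cases hx (fun j => (hy j trivial).1) i
      · obtain ⟨j, rfl⟩ := Fin.exists_succ_eq.mpr hj
        exact (hy j trivial).2
  rw [this, pi_Icc_inter, hr, ENNReal.ofReal_mul (by split_ifs <;> norm_num), mul_pow]
  congr!

lemma lim_0 (n : ℕ) (hq : 2 ≤ n + 1) :
    Tendsto (fun r => (Measure.pi fun _ : Fin (n+1) => nu) (clusterSet obsF doublingMap (n+1) hq 0 r)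
        / ENNReal.ofReal r ^ n)
      (𝓝[>] 0) (𝓝 (ENNReal.ofReal ((1/2)^n * (1/2) + 1^n * (1 - 1/2)))) := by
  have hm : MeasurableSet (Ico (0:ℝ) (1/4) ∪ Ico (1/2) (3/4)) := measurableSet_Ico.union measurableSet_Ico
  have hs : nu (Ico (0:ℝ) (1/4) ∪ Ico (1/2) (3/4)) = ENNReal.ofReal (1/2) := by
    rw [Measure.restrict_apply hm, inter_eq_left.mpr, measure_union _ measurableSet_Ico,
      Real.volume_Ico, Real.volume_Ico, ← ENNReal.ofReal_add (by norm_num) (by norm_num)]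
    · norm_num
    · rw [Set.disjoint_left]; rintro z ⟨_, _⟩ ⟨_, _⟩; linarith
    · rintro z (⟨_, _⟩ | ⟨_, _⟩) <;> constructor <;> linarith
  rw [← int_step _ hm (1/2) (1/2) 1 (by norm_num) (by norm_num) hs (by norm_num) (by norm_num) n]
  refine dct n hq _ (measurableSet_clusterSet _ hq 0) (fun r y hy => hy.1.1) _ ?_
  intro x h hx
  filter_upwards [nu_N h hx] with r hr
  have : {y : Fin n → ℝ | Fin.cons x y ∈ clusterSet obsF doublingMap (n+1) hq 0 r} =
      univ.pi fun _ => Icc 0 1 ∩ {z | |obsF z - obsF x| < r ∧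
        |obsF (doublingMap z) - obsF (doublingMap x)| < r} := by
    ext y
    constructor
    · intro hy j _
      have h2 := hy.2.2 j.succ (Fin.succ_ne_zero j)
      exact ⟨hy.1.1.1 j.succ, hy.1.1.2 j.succ (Fin.succ_ne_zero j), h2⟩
    · intro hy
      refine ⟨⟨⟨fun i => ?_, fun j hj => ?_⟩, by simp⟩, fun i => doubling_mem _, fun j hj => ?_⟩
      · exact Fin.cases hx (fun j => (hy j trivial).1) i
      · obtain ⟨j, rfl⟩ := Fin.exists_succ_eq.mpr hj
        exact (hy j trivial).2.1
      · obtain ⟨j, rfl⟩ := Fin.exists_succ_eq.mpr hj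
        exact (hy j trivial).2.2
  rw [this, pi_Icc_inter, hr, ENNReal.ofReal_mul (by split_ifs <;> norm_num), mul_pow]
  congr!

lemma lim_k (n : ℕ) (hq : 2 ≤ n + 1) (k : ℕ) (hk : 1 ≤ k) :
    Tendsto (fun r => (Measure.pi fun _ : Fin (n+1) => nu) (clusterSet obsF doublingMap (n+1) hq k r)
        / ENNReal.ofReal r ^ n) (𝓝[>] 0) (𝓝 0) := by
  have := dct n hq _ (measurableSet_clusterSet _ hq k) (fun r y hy => hy.1.1) (fun _ => 0) ?_
  · simpa using this
  intro x h hx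
  filter_upwards [cluster_k h k hk] with r hr
  rw [zero_mul]
  convert measure_empty (μ := Measure.pi fun _ : Fin n => nu)
  rw [Set.eq_empty_iff_forall_notMem]
  intro y hy
  have h1 := hy.1.2
  simp only [mem_iInter] at h1
  refine h1 1 (Finset.mem_Icc.mpr ⟨le_rfl, hk⟩) ⟨fun i => doubling_mem _, fun j hj => ?_⟩
  obtain ⟨j, rfl⟩ := Fin.exists_succ_eq.mpr hj
  have a := hy.1.1.2 j.succ (Fin.succ_ne_zero j)
  have b := hy.2.2 j.succ (Fin.succ_ne_zero j)
  rw [iter_prodMap, iter_prodMap] at b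
  exact hr (y j) a b

lemma lim_ratio (n : ℕ) (A B : ℝ → ENNReal) (a b : ℝ) (ha : 0 ≤ a) (hb : 0 < b)
    (hA : Tendsto (fun r => A r / ENNReal.ofReal r ^ n) (𝓝[>] 0) (𝓝 (ENNReal.ofReal a)))
    (hB : Tendsto (fun r => B r / ENNReal.ofReal r ^ n) (𝓝[>] 0) (𝓝 (ENNReal.ofReal b))) :
    Tendsto (fun r => (A r).toReal / (B r).toReal) (𝓝[>] 0) (𝓝 (a / b)) := by
  have hA' := (ENNReal.tendsto_toReal ENNReal.ofReal_ne_top).comp hA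
  have hB' := (ENNReal.tendsto_toReal ENNReal.ofReal_ne_top).comp hB
  rw [ENNReal.toReal_ofReal ha] at hA'
  rw [ENNReal.toReal_ofReal hb.le] at hB'
  refine (hA'.div hB' hb.ne').congr' ?_
  filter_upwards [self_mem_nhdsWithin] with r hr
  have hr' : (0:ℝ) < r := hr
  simp only [Function.comp, Pi.div_apply, ENNReal.toReal_div, ENNReal.toReal_pow, ENNReal.toReal_ofReal hr'.le]
  rw [div_div_div_cancel_right₀ (by positivity)]

/-- For the doubling map, the observation `f` above and Lebesgue measure
`μ` on `[0,1]`: all the limits `p_{k,q}` exist, `p_{0,q} = (2 + 2^{2-q})/(1 + 3^q)`, all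
`p_{k,q}` with `k ≥ 1` vanish, and the extremal index is
`θ_q^f = 1 - Σ_k p_{k,q} = 1 - (2 + 2^{2-q})/(1 + 3^q)`. -/
theorem doubling_extremal_index (q : ℕ) (hq : 2 ≤ q) :
    ∃ p : ℕ → ℝ,
      (∀ k : ℕ, Tendsto
        (fun r : ℝ =>
          ((Measure.pi fun _ : Fin q => (volume.restrict (Set.Icc (0:ℝ) 1)))
              (clusterSet obsF doublingMap q hq k r)).toReal /
            ((Measure.pi fun _ : Fin q => (volume.restrict (Set.Icc (0:ℝ) 1)))
              (obsSet obsF q hq r)).toReal)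
        (𝓝[>] 0) (𝓝 (p k))) ∧
      p 0 = (2 + (2:ℝ) ^ ((2:ℤ) - q)) / (1 + 3 ^ q) ∧
      (∀ k, 1 ≤ k → p k = 0) ∧
      1 - ∑' k, p k = 1 - (2 + (2:ℝ) ^ ((2:ℤ) - q)) / (1 + 3 ^ q) := by

  obtain ⟨n, rfl⟩ : ∃ n, q = n + 1 := ⟨q - 1, by omega⟩
  have hb : (0:ℝ) < 1^n * (1/4) + 3^n * (1 - 1/4) := by norm_num; positivity
  have hval : ((1/2:ℝ)^n * (1/2) + 1^n * (1 - 1/2)) / (1^n * (1/4) + 3^n * (1 - 1/4)) =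
      (2 + (2:ℝ) ^ ((2:ℤ) - (n+1:ℕ))) / (1 + 3 ^ (n+1)) := by
    have : (2:ℝ) ^ ((2:ℤ) - (n+1:ℕ)) = 2 * (1/2)^n := by
      rw [show (2:ℤ) - (n+1:ℕ) = 1 - (n:ℤ) by push_cast; ring, zpow_sub₀ (by norm_num), zpow_one,
        zpow_natCast, one_div, inv_pow, div_eq_mul_inv]
    rw [this, one_pow, div_eq_div_iff (by simpa using hb.ne') (by positivity)]
    ring
  refine ⟨fun k => if k = 0 then (2 + (2:ℝ) ^ ((2:ℤ) - (n+1:ℕ))) / (1 + 3 ^ (n+1)) else 0,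
    ?_, by simp, fun k hk => if_neg (by omega), ?_⟩
  · intro k
    beta_reduce
    rcases Nat.eq_zero_or_pos k with rfl | hk
    · rw [if_pos rfl, ← hval]
      exact lim_ratio n _ _ _ _ (by norm_num; positivity) hb (lim_0 n hq) (lim_obs n hq)
    · rw [if_neg (by omega)]
      have := lim_ratio n _ _ _ _ le_rfl hb (by simpa using lim_k n hq k hk) (lim_obs n hq)
      rw [zero_div] at this
      exact this
  · rw [tsum_ite_eq]
end
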